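/- Let β ≈ 8.13488 be the real root of x³−18x²+110x−242 and α ≈ 1.83928 the real root of x³−x²−x−1. Let H(n) = H(Res(f₀+f₁x+f₂x²+f₃x³, g)) where g is generic of degree n. Then there exist constants c₁, c₂ > 0 and N such that for all n > N: c₁ · αⁿ/n² ≤ β·αⁿ/(nπ) − H(n) ≤ c₂ · αⁿ/n². -/

import Mathlib

noncomputable section

open MvPolynomial

/-- The generic Sylvester matrix of a degree-`m` polynomial `f = f₀ + ⋯ + f_m xᵐ` and a
degree-`n` polynomial `g = g₀ + ⋯ + gₙ xⁿ`: its first `n` columns contain the shifted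
coefficients of `f` (the indeterminates `Sum.inl i`) and its last `m` columns contain the
shifted coefficients of `g` (the indeterminates `Sum.inr j`). -/
def sylvesterMatrix (m n : ℕ) :
    Matrix (Fin (m + n)) (Fin (m + n)) (MvPolynomial (Fin (m + 1) ⊕ Fin (n + 1)) ℤ) :=
  Matrix.of fun i j =>
    if (j : ℕ) < n then
      if h : (j : ℕ) ≤ (i : ℕ) ∧ (i : ℕ) - (j : ℕ) ≤ m then
        X (Sum.inl ⟨(i : ℕ) - (j : ℕ), Nat.lt_succ_of_le h.2⟩)
      else 0
    else
      if h : (j : ℕ) - n ≤ (i : ℕ) ∧ (i : ℕ) - ((j : ℕ) - n) ≤ n then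
        X (Sum.inr ⟨(i : ℕ) - ((j : ℕ) - n), Nat.lt_succ_of_le h.2⟩)
      else 0

/-- `genRes m n` is the Sylvester resultant `Res(f,g)` of the generic polynomials
`f` of degree `m` and `g` of degree `n`. -/
def genRes (m n : ℕ) : MvPolynomial (Fin (m + 1) ⊕ Fin (n + 1)) ℤ :=
  (sylvesterMatrix m n).det

/-- The height of an integer multivariate polynomial:
the maximum of the absolute values of its coefficients. -/
def height {σ : Type*} (P : MvPolynomial σ ℤ) : ℕ :=
  P.support.sup fun s => (P.coeff s).natAbs

/-- Polynomials in two groups of variables, as polynomials in the second group over those in the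
first. -/
def iterHom (σ τ : Type*) : MvPolynomial (σ ⊕ τ) ℤ →+* MvPolynomial τ (MvPolynomial σ ℤ) :=
  eval₂Hom (C.comp C) (Sum.elim (fun i => C (X i)) X)

lemma iterHom_monomial {σ τ : Type*} (s : σ ⊕ τ →₀ ℕ) (c : ℤ) :
    iterHom σ τ (monomial s c) =
      monomial (s.comapDomain Sum.inr Sum.inr_injective.injOn)
        (monomial (s.comapDomain Sum.inl Sum.inl_injective.injOn) c) := by
  classical
  induction s using Finsupp.induction_linear generalizing c with
  | zero => simp [iterHom]
  | add f g hf hg =>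
    have : monomial (f + g) c = monomial f 1 * monomial g c := by simp [monomial_mul]
    rw [this, map_mul, hf, hg, monomial_mul, monomial_mul, one_mul,
      ← Finsupp.comapDomain_add, ← Finsupp.comapDomain_add]
  | single i k =>
    simp only [iterHom, coe_eval₂Hom, eval₂_monomial]
    rw [Finsupp.prod_single_index (by simp)]
    cases i with
    | inl i =>
      have h1 : (Finsupp.single (Sum.inl i : σ ⊕ τ) k).comapDomain Sum.inl Sum.inl_injective.injOn = Finsupp.single i k := Finsupp.comapDomain_single ..
      have h2 : (Finsupp.single (Sum.inl i : σ ⊕ τ) k).comapDomain Sum.inr Sum.inr_injective.injOn = 0 := by ext; simp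
      rw [h1, h2]
      rw [← C_mul_X_pow_eq_monomial, ← C_apply]
      simp
    | inr i =>
      have h1 : (Finsupp.single (Sum.inr i : σ ⊕ τ) k).comapDomain Sum.inr Sum.inr_injective.injOn = Finsupp.single i k := Finsupp.comapDomain_single ..
      have h2 : (Finsupp.single (Sum.inr i : σ ⊕ τ) k).comapDomain Sum.inl Sum.inl_injective.injOn = 0 := by ext; simp
      rw [h1, h2]
      rw [← C_mul_X_pow_eq_monomial]
      rfl

lemma coeff_coeff_iterHom {σ τ : Type*} (p : MvPolynomial (σ ⊕ τ) ℤ) (s : σ ⊕ τ →₀ ℕ) :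
    coeff (s.comapDomain Sum.inl Sum.inl_injective.injOn)
      (coeff (s.comapDomain Sum.inr Sum.inr_injective.injOn) (iterHom σ τ p)) = coeff s p := by
  classical
  induction p using MvPolynomial.induction_on' with
  | add p q hp hq => simp [hp, hq]
  | monomial t c =>
    rw [iterHom_monomial]
    simp only [coeff_monomial]
    by_cases h : t = s
    · simp [h]
    · rw [if_neg h]
      split_ifs with h1
      · rw [coeff_monomial, if_neg]
        intro h2
        apply h
        ext (i | i)
        · simpa using DFunLike.congr_fun h2 i
        · simpa using DFunLike.congr_fun h1 i
      · simp

/-- The coefficient of the monomial `d` in the coefficients of `g`, in `Res(f,g)`. -/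
def gCoeff (n : ℕ) (d : Fin (n + 1) →₀ ℕ) : MvPolynomial (Fin 4) ℤ :=
  coeff d (iterHom (Fin 4) (Fin (n + 1)) (genRes 3 n))

/-- `f` lists the coefficients of the cubic with leading coefficient `f 3` and roots `ρ`. -/
def HasRoots (f : Fin 4 → ℂ) (ρ : Fin 3 → ℂ) : Prop :=
  f 2 = -(f 3 * (ρ 0 + ρ 1 + ρ 2)) ∧ f 1 = f 3 * (ρ 0 * ρ 1 + ρ 0 * ρ 2 + ρ 1 * ρ 2) ∧
    f 0 = -(f 3 * (ρ 0 * ρ 1 * ρ 2))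

lemma exists_hasRoots (f : Fin 4 → ℂ) (h : f 3 ≠ 0) : ∃ ρ, HasRoots f ρ := by
  let P : Polynomial ℂ := (Cubic.mk (f 3) (f 2) (f 1) (f 0)).toPoly
  have := (Cubic.splits_iff_roots_eq_three (P := Cubic.mk (f 3) (f 2) (f 1) (f 0)) (φ := RingHom.id ℂ) h).1 (IsAlgClosed.splits _)
  obtain ⟨x, y, z, h3⟩ := this
  refine ⟨![x, y, z], ?_, ?_, ?_⟩
  · have := Cubic.b_eq_three_roots (φ := RingHom.id ℂ) h h3
    simp only [RingHom.id_apply] at this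
    simp [this]
    ring
  · simpa using Cubic.c_eq_three_roots (φ := RingHom.id ℂ) h h3
  · simpa using Cubic.d_eq_three_roots (φ := RingHom.id ℂ) h h3

open Polynomial in
lemma iter_genRes (n : ℕ) (f : Fin 4 → ℂ) (ρ : Fin 3 → ℂ) (h : HasRoots f ρ) :
    MvPolynomial.map (eval₂Hom (Int.castRingHom ℂ) f) (iterHom (Fin 4) (Fin (n + 1)) (genRes 3 n)) =
      (-1) ^ (n * 3) * (MvPolynomial.C (f 3) ^ n *
        ∏ i : Fin 3, ∑ j : Fin (n + 1), MvPolynomial.C (ρ i ^ (j : ℕ)) * MvPolynomial.X j) := by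
  set Φ : MvPolynomial (Fin 4 ⊕ Fin (n + 1)) ℤ →+* MvPolynomial (Fin (n + 1)) ℂ :=
    (MvPolynomial.map (eval₂Hom (Int.castRingHom ℂ) f)).comp (iterHom (Fin 4) (Fin (n + 1))) with hΦ
  change Φ (genRes 3 n) = _
  let F : Polynomial (MvPolynomial (Fin (n + 1)) ℂ) :=
     ∑ i : Fin 4, Polynomial.C (MvPolynomial.C (f i)) * Polynomial.X ^ (i : ℕ)
  let G : Polynomial (MvPolynomial (Fin (n + 1)) ℂ) :=
     ∑ i : Fin (n + 1), Polynomial.C (MvPolynomial.X i) * Polynomial.X ^ (i : ℕ)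
  have hF : ∀ k (hk : k < 4), F.coeff k = MvPolynomial.C (f ⟨k, hk⟩) := by
    intro k hk
    simp only [F, Polynomial.finsetSum_coeff, Polynomial.coeff_C_mul, Polynomial.coeff_X_pow]
    rw [Finset.sum_eq_single ⟨k, hk⟩]
    · simp
    · intro b _ hb
      rw [if_neg, mul_zero]
      rintro rfl; exact hb rfl
    · simp
  have hG : ∀ k (hk : k < n + 1), G.coeff k = MvPolynomial.X ⟨k, hk⟩ := by
    intro k hk
    simp only [G, Polynomial.finsetSum_coeff, Polynomial.coeff_C_mul, Polynomial.coeff_X_pow]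
    rw [Finset.sum_eq_single ⟨k, hk⟩]
    · simp
    · intro b _ hb
      rw [if_neg, mul_zero]
      rintro rfl; exact hb rfl
    · simp
  have hGd : G.natDegree ≤ n := by
    apply Polynomial.natDegree_sum_le_of_forall_le
    intro i _
    exact (Polynomial.natDegree_C_mul_X_pow_le _ _).trans (by omega)
  have hdet : Φ (genRes 3 n) = Polynomial.resultant G F n 3 := by
    rw [genRes, RingHom.map_det, Polynomial.resultant,
      ← Matrix.det_reindex_self (finCongr (add_comm 3 n))]
    congr 1
    ext1 i j
    simp only [Matrix.reindex_apply, Matrix.submatrix_apply, RingHom.mapMatrix_apply,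
      Matrix.map_apply, sylvesterMatrix, Matrix.of_apply, Polynomial.sylvester]
    induction j using Fin.addCases with
    | left j =>
      simp only [Fin.addCases_left, finCongr_symm, finCongr_apply, Fin.val_cast, Fin.val_castAdd, j.2, if_true,
        Set.mem_Icc]
      by_cases hij : (j : ℕ) ≤ i ∧ (i : ℕ) - j ≤ 3
      · rw [dif_pos hij, if_pos (by omega), hF _ (by omega)]
        simp [hΦ, iterHom]
      · rw [dif_neg hij, if_neg (by omega), map_zero]
    | right j =>
      simp only [Fin.addCases_right, finCongr_symm, finCongr_apply, Fin.val_cast, Fin.val_natAdd,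
        Set.mem_Icc]
      rw [if_neg (by omega)]
      by_cases hij : (j : ℕ) ≤ i ∧ (i : ℕ) - j ≤ n
      · rw [dif_pos (by omega), if_pos (by omega), hG _ (by omega)]
        simp [hΦ, iterHom]
      · rw [dif_neg (by omega), if_neg (by omega), map_zero]
  have hFF : F = Polynomial.C (MvPolynomial.C (f 3)) *
      ((Polynomial.X - Polynomial.C (MvPolynomial.C (ρ 0))) * ((Polynomial.X - Polynomial.C (MvPolynomial.C (ρ 1))) * (Polynomial.X - Polynomial.C (MvPolynomial.C (ρ 2))))) := by
    obtain ⟨h2, h1, h0⟩ := h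
    simp only [F, Fin.sum_univ_four, h0, h1, h2]
    simp
    ring
  have hev : ∀ x : ℂ, G.eval (MvPolynomial.C x) = ∑ j : Fin (n + 1), MvPolynomial.C (x ^ (j : ℕ)) * MvPolynomial.X j := by
    intro x
    simp only [G, Polynomial.eval_finsetSum, Polynomial.eval_mul, Polynomial.eval_C,
      Polynomial.eval_pow, Polynomial.eval_X, MvPolynomial.C_pow]
    exact Finset.sum_congr rfl fun j _ => mul_comm _ _
  rw [hdet, Polynomial.resultant_comm, hFF, Polynomial.resultant_C_mul_left, Fin.prod_univ_three]
  congr 2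
  have h23 := Polynomial.resultant_mul_left (Polynomial.X - Polynomial.C (MvPolynomial.C (ρ 1))) (Polynomial.X - Polynomial.C (MvPolynomial.C (ρ 2))) G n hGd
  have h13 := Polynomial.resultant_mul_left (Polynomial.X - Polynomial.C (MvPolynomial.C (ρ 0))) ((Polynomial.X - Polynomial.C (MvPolynomial.C (ρ 1))) * (Polynomial.X - Polynomial.C (MvPolynomial.C (ρ 2)))) G n hGd
  rw [Polynomial.natDegree_mul (Polynomial.X_sub_C_ne_zero _) (Polynomial.X_sub_C_ne_zero _)] at h13
  simp only [Polynomial.natDegree_X_sub_C, Nat.reduceAdd] at h23 h13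
  rw [h13, h23]
  simp only [Polynomial.resultant_X_sub_C_left _ _ _ hGd, hev]
  ring

/-- The monomial symmetric function of `ρ` attached to the monomial `d` of degree three. -/
def symSum (n : ℕ) (d : Fin (n + 1) →₀ ℕ) (ρ : Fin 3 → ℂ) : ℂ :=
  ∑ i : Fin (n + 1), ∑ j : Fin (n + 1), ∑ k : Fin (n + 1),
    if Finsupp.single i 1 + Finsupp.single j 1 + Finsupp.single k 1 = d then
      ρ 0 ^ (i : ℕ) * ρ 1 ^ (j : ℕ) * ρ 2 ^ (k : ℕ) else 0

lemma eval_gCoeff (n : ℕ) (d : Fin (n + 1) →₀ ℕ) (f : Fin 4 → ℂ) (ρ : Fin 3 → ℂ)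
    (h : HasRoots f ρ) :
    aeval f (gCoeff n d) = (-1) ^ (n * 3) * f 3 ^ n * symSum n d ρ := by
  have h1 := congrArg (coeff d) (iter_genRes n f ρ h)
  rw [coeff_map] at h1
  have h2 : aeval f (gCoeff n d) = eval₂Hom (Int.castRingHom ℂ) f (gCoeff n d) := rfl
  rw [h2, gCoeff, h1]
  have h3 : ((-1) ^ (n * 3) * (C (f 3) ^ n * ∏ i : Fin 3, ∑ j : Fin (n + 1), C (ρ i ^ (j : ℕ)) * X j) : MvPolynomial (Fin (n+1)) ℂ)
     = C ((-1) ^ (n * 3) * f 3 ^ n) * ∏ i : Fin 3, ∑ j : Fin (n + 1), C (ρ i ^ (j : ℕ)) * X j := by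
    simp only [map_mul, map_pow, map_neg, map_one]; ring
  rw [h3, coeff_C_mul]
  congr 1
  rw [Fin.prod_univ_three, Finset.sum_mul_sum, Finset.sum_mul, coeff_sum, symSum]
  refine Finset.sum_congr rfl fun i _ => ?_
  rw [Finset.sum_mul, coeff_sum]
  refine Finset.sum_congr rfl fun j _ => ?_
  rw [Finset.mul_sum, coeff_sum]
  refine Finset.sum_congr rfl fun k _ => ?_
  have : (C (ρ 0 ^ (i : ℕ)) * X i * (C (ρ 1 ^ (j : ℕ)) * X j) * (C (ρ 2 ^ (k : ℕ)) * X k) : MvPolynomial (Fin (n+1)) ℂ)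
    = monomial (Finsupp.single i 1 + Finsupp.single j 1 + Finsupp.single k 1) (ρ 0 ^ (i : ℕ) * ρ 1 ^ (j : ℕ) * ρ 2 ^ (k : ℕ)) := by
    simp only [X, C_mul_monomial, monomial_mul, mul_one]
  rw [this, coeff_monomial]

lemma single_three_eq_iff {m : ℕ} {i j k : Fin m} (hij : i < j) (hjk : j < k) (a b c : Fin m) :
    (Finsupp.single a 1 + Finsupp.single b 1 + Finsupp.single c 1 : Fin m →₀ ℕ) =
      Finsupp.single i 1 + Finsupp.single j 1 + Finsupp.single k 1 ↔
    (a = i ∧ b = j ∧ c = k) ∨ (a = i ∧ b = k ∧ c = j) ∨ (a = j ∧ b = i ∧ c = k) ∨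
    (a = j ∧ b = k ∧ c = i) ∨ (a = k ∧ b = i ∧ c = j) ∨ (a = k ∧ b = j ∧ c = i) := by
  constructor
  · intro h
    have h1 := DFunLike.congr_fun h i
    have h2 := DFunLike.congr_fun h j
    have h3 := DFunLike.congr_fun h k
    simp only [Finsupp.add_apply, Finsupp.single_apply, hij.ne, hjk.ne, (hij.trans hjk).ne, hij.ne', hjk.ne',
      (hij.trans hjk).ne', if_true, if_false] at h1 h2 h3
    grind (splits := 40)
  · rintro (⟨rfl, rfl, rfl⟩ | ⟨rfl, rfl, rfl⟩ | ⟨rfl, rfl, rfl⟩ | ⟨rfl, rfl, rfl⟩ | ⟨rfl, rfl, rfl⟩ | ⟨rfl, rfl, rfl⟩) <;> abel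

lemma single_two_eq_iff {m : ℕ} {i k : Fin m} (hik : i ≠ k) (a b c : Fin m) :
    (Finsupp.single a 1 + Finsupp.single b 1 + Finsupp.single c 1 : Fin m →₀ ℕ) =
      Finsupp.single i 1 + Finsupp.single i 1 + Finsupp.single k 1 ↔
    (a = i ∧ b = i ∧ c = k) ∨ (a = i ∧ b = k ∧ c = i) ∨ (a = k ∧ b = i ∧ c = i) := by
  constructor
  · intro h
    have h1 := DFunLike.congr_fun h i
    have h3 := DFunLike.congr_fun h k
    simp only [Finsupp.add_apply, Finsupp.single_apply] at h1 h3
    grind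
  · rintro (⟨rfl, rfl, rfl⟩ | ⟨rfl, rfl, rfl⟩ | ⟨rfl, rfl, rfl⟩) <;> abel

lemma single_one_eq_iff {m : ℕ} (i : Fin m) (a b c : Fin m) :
    (Finsupp.single a 1 + Finsupp.single b 1 + Finsupp.single c 1 : Fin m →₀ ℕ) =
      Finsupp.single i 1 + Finsupp.single i 1 + Finsupp.single i 1 ↔
    (a = i ∧ b = i ∧ c = i) := by
  constructor
  · intro h
    have h1 := DFunLike.congr_fun h i
    simp only [Finsupp.add_apply, Finsupp.single_apply] at h1
    grind
  · rintro ⟨rfl, rfl, rfl⟩; rfl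

lemma sum_three_ite {m : ℕ} (i j k : Fin m) (t : Fin m → Fin m → Fin m → ℂ) :
    ∑ a, ∑ b, ∑ c, (if a = i ∧ b = j ∧ c = k then t a b c else 0) = t i j k := by
  simp only [ite_and]
  rw [Finset.sum_eq_single i, Finset.sum_eq_single j, Finset.sum_eq_single k] <;> simp +contextual

lemma symSum_three {n : ℕ} {i j k : Fin (n + 1)} (hij : i < j) (hjk : j < k) (ρ : Fin 3 → ℂ) :
    symSum n (Finsupp.single i 1 + Finsupp.single j 1 + Finsupp.single k 1) ρ =
      ρ 0 ^ (i : ℕ) * ρ 1 ^ (j : ℕ) * ρ 2 ^ (k : ℕ) + ρ 0 ^ (i : ℕ) * ρ 1 ^ (k : ℕ) * ρ 2 ^ (j : ℕ) +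
      ρ 0 ^ (j : ℕ) * ρ 1 ^ (i : ℕ) * ρ 2 ^ (k : ℕ) + ρ 0 ^ (j : ℕ) * ρ 1 ^ (k : ℕ) * ρ 2 ^ (i : ℕ) +
      ρ 0 ^ (k : ℕ) * ρ 1 ^ (i : ℕ) * ρ 2 ^ (j : ℕ) + ρ 0 ^ (k : ℕ) * ρ 1 ^ (j : ℕ) * ρ 2 ^ (i : ℕ) := by
  simp only [symSum, single_three_eq_iff hij hjk]
  suffices H : ∀ t : Fin (n + 1) → Fin (n + 1) → Fin (n + 1) → ℂ,
      (∑ a, ∑ b, ∑ c, if a = i ∧ b = j ∧ c = k ∨ a = i ∧ b = k ∧ c = j ∨ a = j ∧ b = i ∧ c = k ∨ a = j ∧ b = k ∧ c = i ∨ a = k ∧ b = i ∧ c = j ∨ a = k ∧ b = j ∧ c = i then t a b c else 0) = t i j k + t i k j + t j i k + t j k i + t k i j + t k j i from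
    H fun a b c => ρ 0 ^ (a : ℕ) * ρ 1 ^ (b : ℕ) * ρ 2 ^ (c : ℕ)
  intro t
  rw [← sum_three_ite i j k t, ← sum_three_ite i k j t, ← sum_three_ite j i k t, ← sum_three_ite j k i t, ← sum_three_ite k i j t, ← sum_three_ite k j i t]
  simp only [← Finset.sum_add_distrib]
  refine Finset.sum_congr rfl fun a _ => Finset.sum_congr rfl fun b _ => Finset.sum_congr rfl fun c _ => ?_
  have := hij.ne; have := hjk.ne; have := (hij.trans hjk).ne
  by_cases h1 : a = i ∧ b = j ∧ c = k
  · grind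
  by_cases h2 : a = i ∧ b = k ∧ c = j
  · grind
  by_cases h3 : a = j ∧ b = i ∧ c = k
  · grind
  by_cases h4 : a = j ∧ b = k ∧ c = i
  · grind
  by_cases h5 : a = k ∧ b = i ∧ c = j
  · grind
  by_cases h6 : a = k ∧ b = j ∧ c = i
  · grind
  simp [h1, h2, h3, h4, h5, h6]

lemma symSum_two {n : ℕ} {i k : Fin (n + 1)} (hik : i ≠ k) (ρ : Fin 3 → ℂ) :
    symSum n (Finsupp.single i 1 + Finsupp.single i 1 + Finsupp.single k 1) ρ =
      ρ 0 ^ (i : ℕ) * ρ 1 ^ (i : ℕ) * ρ 2 ^ (k : ℕ) + ρ 0 ^ (i : ℕ) * ρ 1 ^ (k : ℕ) * ρ 2 ^ (i : ℕ) +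
      ρ 0 ^ (k : ℕ) * ρ 1 ^ (i : ℕ) * ρ 2 ^ (i : ℕ) := by
  simp only [symSum, single_two_eq_iff hik]
  suffices H : ∀ t : Fin (n + 1) → Fin (n + 1) → Fin (n + 1) → ℂ,
      (∑ a, ∑ b, ∑ c, if a = i ∧ b = i ∧ c = k ∨ a = i ∧ b = k ∧ c = i ∨ a = k ∧ b = i ∧ c = i then t a b c else 0) = t i i k + t i k i + t k i i from
    H fun a b c => ρ 0 ^ (a : ℕ) * ρ 1 ^ (b : ℕ) * ρ 2 ^ (c : ℕ)
  intro t
  rw [← sum_three_ite i i k t, ← sum_three_ite i k i t, ← sum_three_ite k i i t]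
  simp only [← Finset.sum_add_distrib]
  refine Finset.sum_congr rfl fun a _ => Finset.sum_congr rfl fun b _ => Finset.sum_congr rfl fun c _ => ?_
  by_cases h1 : a = i ∧ b = i ∧ c = k
  · grind
  by_cases h2 : a = i ∧ b = k ∧ c = i
  · grind
  by_cases h3 : a = k ∧ b = i ∧ c = i
  · grind
  simp [h1, h2, h3]

lemma symSum_one {n : ℕ} (i : Fin (n + 1)) (ρ : Fin 3 → ℂ) :
    symSum n (Finsupp.single i 1 + Finsupp.single i 1 + Finsupp.single i 1) ρ =
      ρ 0 ^ (i : ℕ) * ρ 1 ^ (i : ℕ) * ρ 2 ^ (i : ℕ) := by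
  simp only [symSum, single_one_eq_iff]
  exact sum_three_ite i i i (fun a b c : Fin (n + 1) => ρ 0 ^ (a : ℕ) * ρ 1 ^ (b : ℕ) * ρ 2 ^ (c : ℕ))

lemma ext_of_aeval {P Q : MvPolynomial (Fin 4) ℤ}
    (h : ∀ f : Fin 4 → ℂ, f 0 ≠ 0 → f 3 ≠ 0 → aeval f P = aeval f Q) : P = Q := by
  have h1 : X 0 * X 3 * map (Int.castRingHom ℂ) P = X 0 * X 3 * map (Int.castRingHom ℂ) Q := by
    apply MvPolynomial.funext
    intro f
    simp only [map_mul, eval_X, eval_map]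
    by_cases h0 : f 0 = 0
    · simp [h0]
    by_cases h3 : f 3 = 0
    · simp [h3]
    congr 1
    exact h f h0 h3
  have h2 := mul_left_cancel₀ (mul_ne_zero (X_ne_zero _) (X_ne_zero _)) h1
  exact map_injective _ Int.cast_injective h2

/-- The polynomial in the coefficients of a cubic `f` that gives `f₃ᵏ` times the `k`-th power sum of the
roots. -/
def powSum : ℕ → MvPolynomial (Fin 4) ℤ
  | 0 => 3
  | 1 => -X 2
  | 2 => X 2 ^ 2 - 2 * X 1 * X 3
  | k + 3 => -X 2 * powSum (k + 2) + -X 1 * X 3 * powSum (k + 1) + -X 0 * X 3 ^ 2 * powSum k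

lemma aeval_powSum (k : ℕ) {f : Fin 4 → ℂ} {ρ : Fin 3 → ℂ} (h : HasRoots f ρ) :
    aeval f (powSum k) = f 3 ^ k * (ρ 0 ^ k + ρ 1 ^ k + ρ 2 ^ k) := by
  obtain ⟨h2, h1, h0⟩ := h
  induction k using powSum.induct with
  | case1 => simp [powSum]; norm_num
  | case2 => simp [powSum, h2]
  | case3 => simp [powSum, h2, h1]; ring
  | case4 k ih1 ih2 ih3 =>
    simp only [powSum, map_add, map_mul, map_neg, map_pow, aeval_X, ih1, ih2, ih3, h0, h1, h2, Nat.succ_eq_add_one]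
    ring

/-- The sign by which `Res(f,g)` differs from `f₃ⁿ ∏ g(ρᵢ)`. -/
def sgn (n : ℕ) : MvPolynomial (Fin 4) ℤ := (-1) ^ (n * 3)

lemma gCoeff_two {n : ℕ} {i k : Fin (n + 1)} (hik : i < k) :
    gCoeff n (Finsupp.single i 1 + Finsupp.single i 1 + Finsupp.single k 1) =
      sgn n * ((-X 0) ^ (i : ℕ) * (X 3 ^ (n - k : ℕ) * powSum (k - i))) := by
  apply ext_of_aeval
  intro f h0 h3
  obtain ⟨ρ, h⟩ := exists_hasRoots f h3
  rw [eval_gCoeff n _ f ρ h, symSum_two hik.ne]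
  simp only [sgn, map_mul, map_pow, map_neg, map_one, aeval_X, aeval_powSum _ h, h.2.2]
  obtain ⟨p, hp⟩ := Nat.exists_eq_add_of_lt hik
  obtain ⟨e, he⟩ := Nat.exists_eq_add_of_le (Nat.lt_succ_iff.1 k.2)
  rw [hp] at he ⊢
  rw [show n - (i + p + 1) = e by omega, show (i : ℕ) + p + 1 - i = p + 1 by omega]
  rw [show f 3 ^ n = f 3 ^ ((i : ℕ) + p + 1 + e) by rw [← he]]
  generalize (i : ℕ) = i
  ring

lemma gCoeff_one {n : ℕ} (i : Fin (n + 1)) :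
    gCoeff n (Finsupp.single i 1 + Finsupp.single i 1 + Finsupp.single i 1) =
      sgn n * ((-X 0) ^ (i : ℕ) * (X 3 ^ (n - i : ℕ) * 1)) := by
  apply ext_of_aeval
  intro f h0 h3
  obtain ⟨ρ, h⟩ := exists_hasRoots f h3
  rw [eval_gCoeff n _ f ρ h, symSum_one]
  simp only [sgn, map_mul, map_pow, map_neg, map_one, aeval_X, h.2.2]
  obtain ⟨e, he⟩ := Nat.exists_eq_add_of_le (Nat.lt_succ_iff.1 i.2)
  rw [show n - (i : ℕ) = e by omega]
  rw [show f 3 ^ n = f 3 ^ ((i : ℕ) + e) by rw [← he]]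
  generalize (i : ℕ) = i
  ring

lemma gCoeff_succ {n : ℕ} {i j k : Fin (n + 1)} (hij : (j : ℕ) = i + 1) (p : ℕ) (hk : (k : ℕ) = i + p + 2) :
    gCoeff n (Finsupp.single i 1 + Finsupp.single j 1 + Finsupp.single k 1) =
      sgn n * ((-X 0) ^ (i : ℕ) * (X 3 ^ (n - k : ℕ) * (- (-X 1 * powSum (p + 1) + -X 0 * (X 3 * powSum p))))) := by
  apply ext_of_aeval
  intro f h0 h3
  obtain ⟨ρ, h⟩ := exists_hasRoots f h3
  rw [eval_gCoeff n _ f ρ h, symSum_three (Fin.lt_def.2 (by omega)) (Fin.lt_def.2 (by omega))]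
  simp only [sgn, map_mul, map_pow, map_neg, map_one, map_add, aeval_X, aeval_powSum _ h, h.2.2, h.2.1]
  obtain ⟨e, he⟩ := Nat.exists_eq_add_of_le (Nat.lt_succ_iff.1 k.2)
  rw [hij, hk]
  rw [hk] at he
  rw [show n - (i + p + 2) = e by omega]
  rw [show f 3 ^ n = f 3 ^ ((i : ℕ) + p + 2 + e) by rw [← he]]
  generalize (i : ℕ) = i
  ring

lemma gCoeff_add_three {n : ℕ} {i j k : Fin (n + 1)} (hij : (j : ℕ) = i + 3) (p : ℕ) (hk : (k : ℕ) = i + p + 5) :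
    gCoeff n (Finsupp.single i 1 + Finsupp.single j 1 + Finsupp.single k 1) =
      sgn n * ((-X 0) ^ (i : ℕ) * (X 3 ^ (n - k : ℕ) *
        ((2 * (-X 0 * (-X 0 * (X 3 * powSum (p + 2)))) + 3 * (-X 2 * (-X 1 * (-X 0 * powSum (p + 2)))) +
          -X 2 * (-X 0 * (-X 0 * (X 3 * powSum (p + 1)))) + -X 1 * (-X 0 * (-X 0 * (X 3 * (X 3 * powSum p))))) -
          -X 1 * (-X 1 * (-X 1 * powSum (p + 2)))))) := by
  apply ext_of_aeval
  intro f h0 h3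
  obtain ⟨ρ, h⟩ := exists_hasRoots f h3
  rw [eval_gCoeff n _ f ρ h, symSum_three (Fin.lt_def.2 (by omega)) (Fin.lt_def.2 (by omega))]
  simp only [sgn, map_mul, map_pow, map_neg, map_one, map_add, map_sub, map_ofNat, aeval_X, aeval_powSum _ h, h.2.2, h.2.1, h.1]
  obtain ⟨e, he⟩ := Nat.exists_eq_add_of_le (Nat.lt_succ_iff.1 k.2)
  rw [hij, hk]
  rw [hk] at he
  rw [show n - (i + p + 5) = e by omega]
  rw [show f 3 ^ n = f 3 ^ ((i : ℕ) + p + 5 + e) by rw [← he]]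
  generalize (i : ℕ) = i
  ring

/-- The absolute value of the coefficient of `x₂ᵃ x₁ᵇ x₀ᶜ x₃ᵉ` in the power sum of weight
`a + 2b + 3c`. -/
def wt (a b c : ℕ) : ℝ :=
  if a + b + c = 0 then 3 else
    (a + 2 * b + 3 * c) * (a + b + c - 1).factorial / (a.factorial * b.factorial * c.factorial)

lemma wt_nonneg (a b c : ℕ) : 0 ≤ wt a b c := by
  unfold wt; split_ifs <;> positivity

lemma wt_pred_left (a b c : ℕ) (h : 2 ≤ a + b + c) :
    (if a = 0 then 0 else wt (a - 1) b c) =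
      (a + 2 * b + 3 * c - 1) * a * (a + b + c - 2).factorial /
        (a.factorial * b.factorial * c.factorial) := by
  rcases a with _ | a
  · simp
  · rw [wt, if_neg (by omega), if_neg (by omega)]
    simp only [Nat.add_sub_cancel, Nat.factorial_succ]
    rw [show a + 1 + b + c - 2 = a + b + c - 1 by omega]
    push_cast
    field_simp
    ring

lemma wt_pred_mid (a b c : ℕ) (h : 2 ≤ a + b + c) :
    (if b = 0 then 0 else wt a (b - 1) c) =
      (a + 2 * b + 3 * c - 2) * b * (a + b + c - 2).factorial /
        (a.factorial * b.factorial * c.factorial) := by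
  rcases b with _ | b
  · simp
  · rw [wt, if_neg (by omega), if_neg (by omega)]
    simp only [Nat.add_sub_cancel, Nat.factorial_succ]
    rw [show a + (b + 1) + c - 2 = a + b + c - 1 by omega]
    push_cast
    field_simp
    ring

lemma wt_pred_right (a b c : ℕ) (h : 2 ≤ a + b + c) :
    (if c = 0 then 0 else wt a b (c - 1)) =
      (a + 2 * b + 3 * c - 3) * c * (a + b + c - 2).factorial /
        (a.factorial * b.factorial * c.factorial) := by
  rcases c with _ | c
  · simp
  · rw [wt, if_neg (by omega), if_neg (by omega)]
    simp only [Nat.add_sub_cancel, Nat.factorial_succ]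
    rw [show a + b + (c + 1) - 2 = a + b + c - 1 by omega]
    push_cast
    field_simp
    ring

lemma wt_rec (a b c : ℕ) (h : 3 ≤ a + 2 * b + 3 * c) :
    wt a b c = (if a = 0 then 0 else wt (a - 1) b c) + (if b = 0 then 0 else wt a (b - 1) c) +
      (if c = 0 then 0 else wt a b (c - 1)) := by
  by_cases h2 : 2 ≤ a + b + c
  · rw [wt_pred_left a b c h2, wt_pred_mid a b c h2, wt_pred_right a b c h2, wt, if_neg (by omega)]
    obtain ⟨s, hs⟩ := Nat.exists_eq_add_of_le h2
    have hs' : (a : ℝ) + b + c = 2 + s := by exact_mod_cast hs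
    rw [hs, show 2 + s - 1 = s + 1 by omega, show 2 + s - 2 = s by omega, Nat.factorial_succ]
    push_cast
    field_simp
    linear_combination (-(a : ℝ) - 2 * b - 3 * c) * hs'
  · obtain ⟨rfl, rfl, rfl⟩ : a = 0 ∧ b = 0 ∧ c = 1 := by omega
    simp [wt]

/-- The coefficient of `P` at `u`, with the sign `(-1) ^ (u₀ + u₁ + u₂)`. -/
def signedCoeff (P : MvPolynomial (Fin 4) ℤ) (u : Fin 4 →₀ ℕ) : ℝ :=
  (-1) ^ (u 0 + u 1 + u 2) * ((coeff u P : ℤ) : ℝ)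

lemma abs_signedCoeff (P : MvPolynomial (Fin 4) ℤ) (u : Fin 4 →₀ ℕ) :
    |signedCoeff P u| = |((coeff u P : ℤ) : ℝ)| := by
  simp [signedCoeff, abs_mul]

lemma signedCoeff_add (P Q : MvPolynomial (Fin 4) ℤ) (u : Fin 4 →₀ ℕ) :
    signedCoeff (P + Q) u = signedCoeff P u + signedCoeff Q u := by
  simp [signedCoeff, mul_add]

lemma signedCoeff_sub (P Q : MvPolynomial (Fin 4) ℤ) (u : Fin 4 →₀ ℕ) :
    signedCoeff (P - Q) u = signedCoeff P u - signedCoeff Q u := by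
  simp [signedCoeff, mul_sub]

lemma signedCoeff_X_mul (P : MvPolynomial (Fin 4) ℤ) (u : Fin 4 →₀ ℕ) :
    signedCoeff (X 3 * P) u = if u 3 = 0 then 0 else signedCoeff P (u - Finsupp.single 3 1) := by
  simp only [signedCoeff, coeff_X_mul', Finsupp.mem_support_iff]
  by_cases h : u 3 = 0 <;> simp [h]

lemma signedCoeff_neg_X_mul (P : MvPolynomial (Fin 4) ℤ) (u : Fin 4 →₀ ℕ) {i : Fin 4} (hi : i ≠ 3) :
    signedCoeff (-X i * P) u = if u i = 0 then 0 else signedCoeff P (u - Finsupp.single i 1) := by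
  simp only [signedCoeff, neg_mul, coeff_neg, coeff_X_mul', Finsupp.mem_support_iff]
  by_cases h : u i = 0
  · simp [h]
  · simp only [h, if_false, not_false_eq_true, if_true, ne_eq]
    have : u 0 + u 1 + u 2 = (u - Finsupp.single i 1 : Fin 4 →₀ ℕ) 0 +
        (u - Finsupp.single i 1 : Fin 4 →₀ ℕ) 1 + (u - Finsupp.single i 1 : Fin 4 →₀ ℕ) 2 + 1 := by
      fin_cases i <;> simp at h hi ⊢ <;> omega
    rw [this, pow_succ]
    push_cast [Finsupp.tsub_apply]
    ring

lemma signedCoeff_powSum (k : ℕ) (u : Fin 4 →₀ ℕ) :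
    signedCoeff (powSum k) u =
      if u 2 + 2 * u 1 + 3 * u 0 = k ∧ u 3 = u 1 + 2 * u 0 then wt (u 2) (u 1) (u 0) else 0 := by
  have h1 : ∀ u, signedCoeff 1 u = if u 0 = 0 ∧ u 1 = 0 ∧ u 2 = 0 ∧ u 3 = 0 then 1 else 0 := by
    intro u
    have : 0 = u ↔ u 0 = 0 ∧ u 1 = 0 ∧ u 2 = 0 ∧ u 3 = 0 := by
      rw [eq_comm, Finsupp.ext_iff, Fin.forall_fin_succ, Fin.forall_fin_succ, Fin.forall_fin_two]
      simp
    simp only [signedCoeff, coeff_one, this]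
    split_ifs with h
    · simp [h.1, h.2.1, h.2.2.1]
    · simp
  induction k using powSum.induct generalizing u with
  | case1 =>
    have e : (powSum 0) = 1 + 1 + 1 := by rw [powSum]; norm_num
    rw [e]
    simp only [signedCoeff_add, h1]
    by_cases h : u 0 = 0 ∧ u 1 = 0 ∧ u 2 = 0 ∧ u 3 = 0
    · simp [h, wt]; norm_num
    · rw [if_neg h, if_neg (by omega)]; simp
  | case2 =>
    have e : (powSum 1) = -X 2 * 1 := by rw [powSum]; norm_num
    rw [e, signedCoeff_neg_X_mul _ _ (by decide), h1]
    by_cases h : u 2 + 2 * u 1 + 3 * u 0 = 1 ∧ u 3 = u 1 + 2 * u 0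
    · obtain ⟨h2, h3, h4, h5⟩ : u 0 = 0 ∧ u 1 = 0 ∧ u 2 = 1 ∧ u 3 = 0 := by omega
      simp [h2, h3, h4, h5, wt]
    · rw [if_neg h]
      simp
      omega
  | case3 =>
    have e : (powSum 2) = -X 2 * (-X 2 * 1) + -X 1 * (X 3 * 1) + -X 1 * (X 3 * 1) := by
      rw [powSum]; ring
    rw [e, signedCoeff_add, signedCoeff_add, signedCoeff_neg_X_mul _ _ (by decide),
      signedCoeff_neg_X_mul _ _ (by decide), signedCoeff_neg_X_mul _ _ (by decide),
      signedCoeff_X_mul, h1, h1]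
    by_cases h : u 2 + 2 * u 1 + 3 * u 0 = 2 ∧ u 3 = u 1 + 2 * u 0
    · obtain ⟨h2, h3, h4, h5⟩ | ⟨h2, h3, h4, h5⟩ : (u 0 = 0 ∧ u 1 = 0 ∧ u 2 = 2 ∧ u 3 = 0) ∨
        (u 0 = 0 ∧ u 1 = 1 ∧ u 2 = 0 ∧ u 3 = 1) := by omega
      · simp [h2, h3, h4, h5, wt]
      · simp [h2, h3, h4, h5, wt]; norm_num
    · rw [if_neg h]
      simp
      split_ifs <;> first | omega | norm_num
  | case4 k ih1 ih2 ih3 =>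
    have e : powSum (k + 3) = -X 2 * powSum (k + 2) + -X 1 * (X 3 * powSum (k + 1)) +
        -X 0 * (X 3 * (X 3 * powSum k)) := by
      rw [powSum]; ring
    change signedCoeff (powSum (k + 3)) u = if _ = k + 3 ∧ _ then _ else _
    rw [e, signedCoeff_add, signedCoeff_add, signedCoeff_neg_X_mul _ _ (by decide),
      signedCoeff_neg_X_mul _ _ (by decide), signedCoeff_neg_X_mul _ _ (by decide),
      signedCoeff_X_mul, signedCoeff_X_mul, signedCoeff_X_mul, ih1, ih2, ih3]
    simp only [Finsupp.tsub_apply, Finsupp.single_apply]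
    simp
    generalize u 0 = c, u 1 = b, u 2 = a, u 3 = d
    by_cases h : a + 2 * b + 3 * c = k + 3 ∧ d = b + 2 * c
    · rw [if_pos h, wt_rec a b c (by omega)]
      congr 1
      · congr 1
        · split_ifs <;> first | rfl | omega
        · split_ifs <;> first | rfl | omega
      · split_ifs <;> first | rfl | omega
    · rw [if_neg h]
      split_ifs <;> first | omega | norm_num

lemma hasDerivAt_entropyOdd {x : ℝ} (h0 : -1 < x) (h1 : x < 1) :
    HasDerivAt (fun x : ℝ => (1 + x) * Real.log (1 + x) - (1 - x) * Real.log (1 - x))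
      (2 + Real.log (1 + x) + Real.log (1 - x)) x := by
  have e1 : HasDerivAt (fun x : ℝ => 1 + x) 1 x := (hasDerivAt_id x).const_add 1
  have e2 : HasDerivAt (fun x : ℝ => 1 - x) (-1) x := (hasDerivAt_id x).const_sub 1
  have h1' : 1 - x ≠ 0 := by linarith
  have h0' : 1 + x ≠ 0 := by linarith
  refine ((e1.mul (e1.log h0')).sub (e2.mul (e2.log h1'))).congr_deriv ?_
  field_simp
  ring

lemma entropyOdd_le {x : ℝ} (h0 : 0 ≤ x) (h1 : x < 1) :
    (1 + x) * Real.log (1 + x) - (1 - x) * Real.log (1 - x) ≤ 2 * x := by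
  have hd : ∀ y ∈ Set.Ico (0 : ℝ) 1, HasDerivAt (fun x : ℝ => 2 * x -
      ((1 + x) * Real.log (1 + x) - (1 - x) * Real.log (1 - x)))
      (2 * 1 - (2 + Real.log (1 + y) + Real.log (1 - y))) y := fun y hy =>
    ((hasDerivAt_id y).const_mul 2).sub (hasDerivAt_entropyOdd (by linarith [hy.1]) hy.2)
  have hm : MonotoneOn (fun x : ℝ => 2 * x -
      ((1 + x) * Real.log (1 + x) - (1 - x) * Real.log (1 - x))) (Set.Ico 0 1) := by
    apply monotoneOn_of_deriv_nonneg (convex_Ico 0 1)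
    · exact fun y hy => (hd y hy).continuousAt.continuousWithinAt
    · exact fun y hy => (hd y (interior_subset hy)).differentiableAt.differentiableWithinAt
    · intro y hy
      have hy' := interior_subset hy
      rw [(hd y hy').deriv]
      have := Real.log_le_sub_one_of_pos (show 0 < 1 + y by linarith [hy'.1])
      have := Real.log_le_sub_one_of_pos (show 0 < 1 - y by linarith [hy'.2])
      linarith
  have := hm ⟨le_rfl, one_pos⟩ ⟨h0, h1⟩ h0
  simp at this
  linarith

lemma le_entropyOdd {x : ℝ} (h0 : 0 ≤ x) (h1 : x < 1) :
    2 * x - x ^ 3 / (3 * (1 - x ^ 2)) ≤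
      (1 + x) * Real.log (1 + x) - (1 - x) * Real.log (1 - x) := by
  have hd : ∀ y ∈ Set.Ico (0 : ℝ) 1, HasDerivAt (fun x : ℝ =>
      ((1 + x) * Real.log (1 + x) - (1 - x) * Real.log (1 - x)) -
        (2 * x - x ^ 3 / (3 * (1 - x ^ 2))))
      ((2 + Real.log (1 + y) + Real.log (1 - y)) - (2 * 1 -
        (3 * y ^ 2 * (3 * (1 - y ^ 2)) - y ^ 3 * (3 * (-(2 * y)))) / (3 * (1 - y ^ 2)) ^ 2)) y := by
    intro y hy
    have h2 : HasDerivAt (fun x : ℝ => x ^ 2) (2 * y) y := by simpa using hasDerivAt_pow 2 y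
    have h3 : HasDerivAt (fun x : ℝ => x ^ 3) (3 * y ^ 2) y := by simpa using hasDerivAt_pow 3 y
    have hne : 3 * (1 - y ^ 2) ≠ 0 := by nlinarith [hy.1, hy.2]
    exact (hasDerivAt_entropyOdd (by linarith [hy.1]) hy.2).sub
      (((hasDerivAt_id y).const_mul 2).sub (h3.div ((h2.const_sub 1).const_mul 3) hne))
  have hm : MonotoneOn (fun x : ℝ =>
      ((1 + x) * Real.log (1 + x) - (1 - x) * Real.log (1 - x)) -
        (2 * x - x ^ 3 / (3 * (1 - x ^ 2)))) (Set.Ico 0 1) := by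
    apply monotoneOn_of_deriv_nonneg (convex_Ico 0 1)
    · exact fun y hy => (hd y hy).continuousAt.continuousWithinAt
    · exact fun y hy => (hd y (interior_subset hy)).differentiableAt.differentiableWithinAt
    · intro y hy
      have hy' := interior_subset hy
      rw [(hd y hy').deriv]
      have p1 : 0 < 1 + y := by linarith [hy'.1]
      have p2 : 0 < 1 - y := by linarith [hy'.2]
      have p3 : 0 < 1 - y ^ 2 := by nlinarith
      have e := Real.one_sub_inv_le_log_of_pos p3
      rw [show 1 - y ^ 2 = (1 + y) * (1 - y) by ring, Real.log_mul p1.ne' p2.ne',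
        show (1 + y) * (1 - y) = 1 - y ^ 2 by ring] at e
      have e2 : (3 * y ^ 2 * (3 * (1 - y ^ 2)) - y ^ 3 * (3 * (-(2 * y)))) / (3 * (1 - y ^ 2)) ^ 2 =
          ((1 - y ^ 2)⁻¹ - 1) + 2 / 3 * y ^ 4 / (1 - y ^ 2) ^ 2 := by
        field_simp
        ring
      have : 0 ≤ 2 / 3 * y ^ 4 / (1 - y ^ 2) ^ 2 := by positivity
      rw [e2]
      linarith
  have := hm ⟨le_rfl, one_pos⟩ ⟨h0, h1⟩ h0
  simp at this
  linarith

/-- The error in the approximation of `log n!` by `½ log 2π + (n + ½) log (n + ½) - (n + ½)`. -/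
def stirlingErr (n : ℕ) : ℝ :=
  Real.log n.factorial -
    (Real.log (2 * Real.pi) / 2 + (n + 1 / 2) * Real.log (n + 1 / 2) - (n + 1 / 2))

lemma stirlingErr_succ_sub (n : ℕ) :
    stirlingErr (n + 1) - stirlingErr n = 1 - (n + 1) * ((1 + 1 / (2 * (n + 1))) *
      Real.log (1 + 1 / (2 * (n + 1))) - (1 - 1 / (2 * (n + 1))) * Real.log (1 - 1 / (2 * (n + 1)))) := by
  have hn : (0 : ℝ) < n + 1 := by positivity
  have e1 : (1 + 1 / (2 * (n + 1)) : ℝ) = (n + 1 + 1 / 2) / (n + 1) := by field_simp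
  have e2 : (1 - 1 / (2 * (n + 1)) : ℝ) = (n + 1 / 2) / (n + 1) := by field_simp; ring
  rw [e1, e2, Real.log_div (by positivity) hn.ne', Real.log_div (by positivity) hn.ne', stirlingErr,
    stirlingErr, Nat.factorial_succ]
  push_cast
  rw [Real.log_mul (by positivity) (by positivity)]
  field_simp
  ring

lemma tendsto_stirlingErr : Filter.Tendsto stirlingErr Filter.atTop (nhds 0) := by
  have h1 := (Real.continuousAt_log (by positivity)).tendsto.comp Stirling.tendsto_stirlingSeq_sqrt_pi
  have h2 := (Real.tendsto_mul_log_one_add_div_atTop (1 / 2)).comp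
    (tendsto_natCast_atTop_atTop (R := ℝ))
  have h3 : Filter.Tendsto (fun n : ℕ => Real.log (1 + (1 / 2) / (n : ℝ))) Filter.atTop (nhds 0) := by
    have : Filter.Tendsto (fun n : ℕ => 1 + (1 / 2) / (n : ℝ)) Filter.atTop (nhds (1 + 0)) :=
      tendsto_const_nhds.add (tendsto_const_nhds.div_atTop tendsto_natCast_atTop_atTop)
    have := (Real.continuousAt_log (by norm_num)).tendsto.comp this
    simpa [Function.comp_def] using this
  have h4 := (((h1.sub h2).sub (h3.const_mul (1 / 2))).add_const (1 / 2 - Real.log (Real.pi) / 2))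
  have e : Real.log (Real.sqrt Real.pi) - 1 / 2 - 1 / 2 * 0 + (1 / 2 - Real.log Real.pi / 2) = 0 := by
    rw [Real.log_sqrt Real.pi_pos.le]; ring
  rw [e] at h4
  refine h4.congr' ?_
  filter_upwards [Filter.eventually_gt_atTop 0] with n hn
  have hn' : (0 : ℝ) < n := by exact_mod_cast hn
  have e1 : (1 + 1 / 2 / (n : ℝ)) = (n + 1 / 2) / n := by field_simp
  simp only [Function.comp, e1]
  rw [Stirling.log_stirlingSeq_formula, stirlingErr, Real.log_div (by positivity) (by positivity),
    Real.log_div (by positivity) (by positivity), Real.log_mul (by positivity) (by positivity),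
    Real.log_mul (by positivity) (by positivity), Real.log_exp]
  ring

lemma stirlingErr_nonpos (n : ℕ) : stirlingErr n ≤ 0 := by
  refine (monotone_nat_of_le_succ fun n => ?_).ge_of_tendsto tendsto_stirlingErr n
  have hn : (0 : ℝ) < n + 1 := by positivity
  have h := entropyOdd_le (x := 1 / (2 * ((n : ℝ) + 1))) (by positivity)
    (by rw [div_lt_one (by positivity)]; linarith)
  have e := stirlingErr_succ_sub n
  have := mul_le_mul_of_nonneg_left h hn.le
  have e2 : ((n : ℝ) + 1) * (2 * (1 / (2 * (n + 1)))) = 1 := by field_simp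
  linarith

lemma neg_le_stirlingErr (n : ℕ) : -(1 / (24 * (n + 1 / 2))) ≤ stirlingErr n := by
  have ht : Filter.Tendsto (fun n : ℕ => stirlingErr n + 1 / (24 * ((n : ℝ) + 1 / 2)))
      Filter.atTop (nhds (0 + 0)) := by
    refine tendsto_stirlingErr.add (tendsto_const_nhds.div_atTop ?_)
    exact (Filter.tendsto_atTop_add_const_right _ _ tendsto_natCast_atTop_atTop).const_mul_atTop
      (by norm_num)
  rw [add_zero] at ht
  have := (antitone_nat_of_succ_le (f := fun n : ℕ => stirlingErr n + 1 / (24 * ((n : ℝ) + 1 / 2)))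
    fun n => ?_).le_of_tendsto ht n
  · linarith
  have hn : (0 : ℝ) < n + 1 := by positivity
  have hx : 1 / (2 * ((n : ℝ) + 1)) < 1 := by rw [div_lt_one (by positivity)]; linarith
  have h := le_entropyOdd (x := 1 / (2 * ((n : ℝ) + 1))) (by positivity) hx
  have e := stirlingErr_succ_sub n
  have := mul_le_mul_of_nonneg_left h hn.le
  have e2 : ((n : ℝ) + 1) * (2 * (1 / (2 * (n + 1))) - (1 / (2 * ((n : ℝ) + 1))) ^ 3 /
      (3 * (1 - (1 / (2 * ((n : ℝ) + 1))) ^ 2))) =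
      1 - (1 / (24 * ((n : ℝ) + 1 / 2)) - 1 / (24 * ((n : ℝ) + 1 + 1 / 2))) := by
    have : (1 - (1 / (2 * ((n : ℝ) + 1))) ^ 2) = (n + 1 / 2) * (n + 1 + 1 / 2) / (n + 1) ^ 2 := by
      field_simp; ring
    rw [this]
    field_simp
    ring
  push_cast
  linarith

lemma pade_le_log {t : ℝ} (ht : 0 < t) : (5 * t ^ 2 - 4 * t - 1) / (2 * t ^ 2 + 4 * t) ≤ Real.log t := by
  have hd : ∀ y ∈ Set.Ioi (0 : ℝ), HasDerivAt
      (fun t : ℝ => Real.log t - (5 * t ^ 2 - 4 * t - 1) / (2 * t ^ 2 + 4 * t))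
      ((y - 1) ^ 3 / (y ^ 2 * (y + 2) ^ 2)) y := by
    intro y hy
    have hy : 0 < y := hy
    have h2 : HasDerivAt (fun x : ℝ => x ^ 2) (2 * y) y := by simpa using hasDerivAt_pow 2 y
    have hne : 2 * y ^ 2 + 4 * y ≠ 0 := by positivity
    refine ((Real.hasDerivAt_log hy.ne').sub ((((h2.const_mul 5).sub
      ((hasDerivAt_id y).const_mul 4)).sub_const 1).div
      ((h2.const_mul 2).add ((hasDerivAt_id y).const_mul 4)) hne)).congr_deriv ?_
    have h3 : 2 * y ^ 2 + 4 * y = 2 * (y * (y + 2)) := by ring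
    simp only [id, Pi.add_apply, Pi.sub_apply]
    rw [h3]
    have : y + 2 ≠ 0 := by positivity
    field_simp
    ring
  have hc : ∀ D ⊆ Set.Ioi (0 : ℝ), ContinuousOn
      (fun t : ℝ => Real.log t - (5 * t ^ 2 - 4 * t - 1) / (2 * t ^ 2 + 4 * t)) D :=
    fun D hD y hy => (hd y (hD hy)).continuousAt.continuousWithinAt
  rcases le_total 1 t with h | h
  · have hs : Set.Ici (1 : ℝ) ⊆ Set.Ioi 0 := fun y hy =>
      Set.mem_Ioi.2 (lt_of_lt_of_le one_pos hy)
    have hm := monotoneOn_of_deriv_nonneg (convex_Ici 1) (hc _ hs)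
      (fun y hy => (hd y (hs (interior_subset hy))).differentiableAt.differentiableWithinAt)
      (fun y hy => by
        rw [(hd y (hs (interior_subset hy))).deriv]
        have : (1 : ℝ) ≤ y := interior_subset hy
        have : 0 ≤ y - 1 := by linarith
        positivity)
    have := hm (Set.mem_Ici.2 le_rfl) (Set.mem_Ici.2 h) h
    norm_num at this
    linarith
  · have hs : Set.Ioc (0 : ℝ) 1 ⊆ Set.Ioi 0 := fun y hy => hy.1
    have hm := antitoneOn_of_deriv_nonpos (convex_Ioc 0 1) (hc _ hs)
      (fun y hy => (hd y (hs (interior_subset hy))).differentiableAt.differentiableWithinAt)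
      (fun y hy => by
        rw [(hd y (hs (interior_subset hy))).deriv]
        have h1 : y ≤ 1 := (interior_subset hy).2
        have h2 : (y - 1) ^ 3 ≤ 0 := by
          have : 0 ≤ (1 - y) ^ 3 := pow_nonneg (by linarith) 3
          nlinarith
        exact div_nonpos_of_nonpos_of_nonneg h2 (by positivity))
    have := hm ⟨ht, h⟩ ⟨one_pos, le_rfl⟩ h
    norm_num at this
    linarith

lemma le_mul_log_div {P q : ℝ} (hP : 0 < P) (hq : 0 < q) :
    P - q + 3 / 2 * (|P - q| ^ 2 / (P + 2 * q)) ≤ P * Real.log (P / q) := by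
  have h := mul_le_mul_of_nonneg_left (pade_le_log (div_pos hP hq)) hP.le
  refine le_trans (le_of_eq ?_) h
  rw [sq_abs]
  have : 2 * (P / q) ^ 2 + 4 * (P / q) = 2 * P * (P + 2 * q) / q ^ 2 := by
    field_simp
    ring
  rw [this]
  field_simp
  ring

/-- Pinsker's inequality on a finite type. -/
lemma pinsker {ι : Type*} [Fintype ι] (P q : ι → ℝ) (hP : ∀ i, 0 < P i) (hq : ∀ i, 0 < q i)
    (hP1 : ∑ i, P i = 1) (hq1 : ∑ i, q i = 1) :
    (∑ i, |P i - q i|) ^ 2 / 2 ≤ ∑ i, P i * Real.log (P i / q i) := by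
  have h := Finset.sum_le_sum fun i (_ : i ∈ Finset.univ) => le_mul_log_div (hP i) (hq i)
  have h2 := Finset.sq_sum_div_le_sum_sq_div Finset.univ (fun i => |P i - q i|)
    (g := fun i => P i + 2 * q i) (fun i _ => by have := hP i; have := hq i; positivity)
  simp only [Finset.sum_add_distrib, Finset.sum_sub_distrib, ← Finset.mul_sum, hP1, hq1] at h h2
  linarith

lemma mul_log_div_le {ι : Type*} [Fintype ι] (P q : ι → ℝ) (hP : ∀ i, 0 < P i) (hq : ∀ i, 0 < q i)
    (hP1 : ∑ i, P i = 1) (hq1 : ∑ i, q i = 1) :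
    ∑ i, P i * Real.log (P i / q i) ≤ ∑ i, (P i - q i) ^ 2 / q i := by
  have h : ∀ i, P i * Real.log (P i / q i) ≤ (P i - q i) ^ 2 / q i + (P i - q i) := by
    intro i
    have hP := hP i
    have hq := hq i
    have h := mul_le_mul_of_nonneg_left (Real.log_le_sub_one_of_pos (div_pos hP hq)) hP.le
    refine h.trans (le_of_eq ?_)
    field_simp
    ring
  have := Finset.sum_le_sum fun i (_ : i ∈ Finset.univ) => h i
  simp only [Finset.sum_add_distrib, Finset.sum_sub_distrib, hP1, hq1] at this
  linarith

/-- The mean of the distribution `i ↦ α⁻ⁱ` on `{1, 2, 3}`. -/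
def meanIdx (α : ℝ) : ℝ := 1 / α + 2 / α ^ 2 + 3 / α ^ 3

/-- The leading term of the largest coefficient of weight `n`. -/
def mainTerm (α : ℝ) (n : ℕ) : ℝ := α ^ (n + 3) * meanIdx α ^ 2 / (2 * Real.pi * n)

/-- The relative entropy term. -/
def relEnt (α A B C : ℝ) : ℝ :=
  A * Real.log (A * α / (A + B + C)) + B * Real.log (B * α ^ 2 / (A + B + C)) +
    C * Real.log (C * α ^ 3 / (A + B + C))

lemma log_wt_div {α : ℝ} (hα : 1 < α) {a b c n : ℕ} (hn : a + 2 * b + 3 * c = n) (hn0 : 0 < n)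
    {A B C S : ℝ} (hA : A = a + 1 / 2) (hB : B = b + 1 / 2) (hC : C = c + 1 / 2) (hS : S = A + B + C) :
    0 < wt a b c ∧ 2 < S ∧ Real.log (wt a b c / mainTerm α n) =
      2 * Real.log (n / (meanIdx α * S)) + ((S - 2) * Real.log (1 - 2 / S) + 2) - relEnt α A B C +
        stirlingErr (a + b + c - 1) - stirlingErr a - stirlingErr b - stirlingErr c := by
  have hα0 : 0 < α := by linarith
  have hn' : (a + 2 * b + 3 * c : ℝ) = n := by exact_mod_cast hn
  have hμ : 0 < meanIdx α := by unfold meanIdx; positivity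
  have hnpos : (0 : ℝ) < n := by exact_mod_cast hn0
  have hs : 1 ≤ a + b + c := by omega
  have hs' : (1 : ℝ) ≤ a + b + c := by exact_mod_cast hs
  have hA0 : 0 < A := by rw [hA]; positivity
  have hB0 : 0 < B := by rw [hB]; positivity
  have hC0 : 0 < C := by rw [hC]; positivity
  have hS2 : 2 < S := by rw [hS, hA, hB, hC]; linarith
  have hS0 : 0 < S := by linarith
  have hw : wt a b c = n * (a + b + c - 1).factorial / (a.factorial * b.factorial * c.factorial) := by
    rw [wt, if_neg (by omega), hn']
  have hpos : 0 < wt a b c := by rw [hw]; positivity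
  refine ⟨hpos, hS2, ?_⟩
  have e1 : Real.log (wt a b c) = Real.log n + Real.log (a + b + c - 1).factorial -
      (Real.log a.factorial + Real.log b.factorial + Real.log c.factorial) := by
    rw [hw, Real.log_div (by positivity) (by positivity), Real.log_mul (by positivity) (by positivity),
      Real.log_mul (by positivity) (by positivity), Real.log_mul (by positivity) (by positivity)]
  have e2 : Real.log (mainTerm α n) = (n + 3) * Real.log α + 2 * Real.log (meanIdx α) -
      (Real.log (2 * Real.pi) + Real.log n) := by
    rw [mainTerm, Real.log_div (by positivity) (by positivity), Real.log_mul (by positivity) (by positivity),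
      Real.log_mul (by positivity) (by positivity), Real.log_pow, Real.log_pow]
    push_cast
    ring
  have e3 : Real.log (1 - 2 / S) = Real.log (S - 2) - Real.log S := by
    rw [← Real.log_div (by linarith) hS0.ne']
    congr 1
    field_simp
  have hm : 0 < mainTerm α n := by unfold mainTerm; positivity
  rw [Real.log_div hpos.ne' hm.ne', e1, e2, e3, Real.log_div hnpos.ne' (by positivity),
    Real.log_mul hμ.ne' hS0.ne', relEnt, ← hS, Real.log_div (by positivity) hS0.ne',
    Real.log_div (by positivity) hS0.ne', Real.log_div (by positivity) hS0.ne',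
    Real.log_mul hA0.ne' hα0.ne', Real.log_mul hB0.ne' (by positivity),
    Real.log_mul hC0.ne' (by positivity), Real.log_pow, Real.log_pow, stirlingErr, stirlingErr,
    stirlingErr, stirlingErr, Nat.cast_sub hs]
  push_cast
  rw [show ((a : ℝ) + b + c - 1 + 1 / 2) = S - 2 by rw [hS, hA, hB, hC]; ring, ← hA, ← hB, ← hC]
  have hn3 : (n : ℝ) = A + 2 * B + 3 * C - 3 := by rw [← hn', hA, hB, hC]; ring
  generalize Real.log n = ln
  rw [hn3, hS]
  ring

section Bounds

variable {α : ℝ} (hα : α ^ 3 - α ^ 2 - α - 1 = 0)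
include hα

lemma lt_root : 1.839 < α := by
  by_contra! h
  nlinarith [sq_nonneg (α + 0.4195), mul_nonneg (sub_nonneg.2 h) (add_nonneg (sq_nonneg (α + 0.4195)) (by norm_num : (0 : ℝ) ≤ 0.3))]

lemma root_lt : α < 1.84 := by
  by_contra! h
  nlinarith [sq_nonneg (α + 0.4195), mul_nonneg (sub_nonneg.2 h) (add_nonneg (sq_nonneg (α + 0.4195)) (by norm_num : (0 : ℝ) ≤ 0.3))]

lemma inv_root_bounds : (0.543 < 1 / α ∧ 1 / α < 0.544) ∧ (0.295 < 1 / α ^ 2 ∧ 1 / α ^ 2 < 0.296) ∧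
    (0.16 < 1 / α ^ 3 ∧ 1 / α ^ 3 < 0.161) := by
  have h1 := lt_root hα
  have h2 := root_lt hα
  have h0 : 0 < α := by linarith
  have a1 : (1.839 : ℝ) ^ 2 < α ^ 2 := by gcongr
  have a2 : α ^ 2 < 1.84 ^ 2 := by gcongr
  have a3 : (1.839 : ℝ) ^ 3 < α ^ 3 := by gcongr
  have a4 : α ^ 3 < 1.84 ^ 3 := by gcongr
  norm_num at a1 a2 a3 a4 h1 h2
  refine ⟨⟨?_, ?_⟩, ⟨?_, ?_⟩, ⟨?_, ?_⟩⟩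
  all_goals first | rw [lt_div_iff₀ (by positivity)] | rw [div_lt_iff₀ (by positivity)]
  all_goals linarith

lemma inv_root_sum : 1 / α + 1 / α ^ 2 + 1 / α ^ 3 = 1 := by
  have h0 : 0 < α := by linarith [lt_root hα]
  field_simp
  linarith

lemma meanIdx_bounds : 1.612 < meanIdx α ∧ meanIdx α < 1.62 := by
  obtain ⟨⟨h1, h2⟩, ⟨h3, h4⟩, h5, h6⟩ := inv_root_bounds hα
  have hs := inv_root_sum hα
  have : meanIdx α = 1 / α + 2 * (1 / α ^ 2) + 3 * (1 / α ^ 3) := by unfold meanIdx; ring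
  constructor <;> linarith

lemma relEnt_eq {A B C S : ℝ} (hS : S = A + B + C) (hS0 : 0 < S) :
    relEnt α A B C = S * ∑ i, ![A / S, B / S, C / S] i *
      Real.log (![A / S, B / S, C / S] i / ![1 / α, 1 / α ^ 2, 1 / α ^ 3] i) := by
  have h0 : 0 < α := by linarith [lt_root hα]
  rw [relEnt, ← hS]
  simp only [Fin.sum_univ_three, Matrix.cons_val_zero, Matrix.cons_val_one, Matrix.cons_val_two,
    Matrix.head_cons, Matrix.tail_cons, Matrix.cons_val]
  have e : ∀ x y : ℝ, x / S / (1 / y) = x * y / S := fun x y => by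
    rw [div_div_eq_mul_div, div_one]; ring
  rw [e, e, e]
  field_simp

lemma le_relEnt {A B C S : ℝ} (hS : S = A + B + C) (hA : 0 < A) (hB : 0 < B) (hC : 0 < C) :
    S * ((|A / S - 1 / α| + |B / S - 1 / α ^ 2| + |C / S - 1 / α ^ 3|) ^ 2 / 2) ≤ relEnt α A B C := by
  have h0 : 0 < α := by linarith [lt_root hα]
  have hS0 : 0 < S := by rw [hS]; positivity
  rw [relEnt_eq hα hS hS0]
  have := pinsker ![A / S, B / S, C / S] ![1 / α, 1 / α ^ 2, 1 / α ^ 3]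
    (by simp [Fin.forall_fin_succ]; refine ⟨?_, ?_, ?_⟩ <;> positivity)
    (by simp [Fin.forall_fin_succ]; refine ⟨?_, ?_, ?_⟩ <;> positivity)
    (by simp [Fin.sum_univ_three]; rw [← add_div, ← add_div, ← hS, div_self hS0.ne'])
    (by have := inv_root_sum hα; simpa [Fin.sum_univ_three] using this)
  refine mul_le_mul_of_nonneg_left (le_trans (le_of_eq ?_) this) hS0.le
  simp [Fin.sum_univ_three]

lemma relEnt_le {A B C S : ℝ} (hS : S = A + B + C) (hA : 0 < A) (hB : 0 < B) (hC : 0 < C) :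
    relEnt α A B C ≤ S * ((A / S - 1 / α) ^ 2 * α + (B / S - 1 / α ^ 2) ^ 2 * α ^ 2 +
      (C / S - 1 / α ^ 3) ^ 2 * α ^ 3) := by
  have h0 : 0 < α := by linarith [lt_root hα]
  have hS0 : 0 < S := by rw [hS]; positivity
  rw [relEnt_eq hα hS hS0]
  have := mul_log_div_le ![A / S, B / S, C / S] ![1 / α, 1 / α ^ 2, 1 / α ^ 3]
    (by simp [Fin.forall_fin_succ]; refine ⟨?_, ?_, ?_⟩ <;> positivity)
    (by simp [Fin.forall_fin_succ]; refine ⟨?_, ?_, ?_⟩ <;> positivity)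
    (by simp [Fin.sum_univ_three]; rw [← add_div, ← add_div, ← hS, div_self hS0.ne'])
    (by have := inv_root_sum hα; simpa [Fin.sum_univ_three] using this)
  refine mul_le_mul_of_nonneg_left (this.trans (le_of_eq ?_)) hS0.le
  simp [Fin.sum_univ_three]

end Bounds

lemma log_one_sub_le {y : ℝ} (h0 : 0 ≤ y) (h1 : y < 1) : Real.log (1 - y) ≤ -y - y ^ 2 / 2 := by
  have hp : 0 < 1 - y := by linarith
  have h := pade_le_log (inv_pos.2 hp)
  rw [Real.log_inv] at h
  have e : (5 * (1 - y)⁻¹ ^ 2 - 4 * (1 - y)⁻¹ - 1) / (2 * (1 - y)⁻¹ ^ 2 + 4 * (1 - y)⁻¹) =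
      y * (6 - y) / (6 - 4 * y) := by
    have h2 : 2 * (1 - y)⁻¹ ^ 2 + 4 * (1 - y)⁻¹ = (6 - 4 * y) / (1 - y) ^ 2 := by
      field_simp
      ring
    rw [h2]
    have : 6 - 4 * y ≠ 0 := by linarith
    field_simp
    ring
  rw [e] at h
  have h3 : y + y ^ 2 / 2 ≤ y * (6 - y) / (6 - 4 * y) := by
    rw [le_div_iff₀ (by linarith)]
    nlinarith [pow_nonneg h0 3]
  linarith

lemma mul_log_one_sub_le {S : ℝ} (hS : 2 < S) :
    (S - 2) * Real.log (1 - 2 / S) + 2 ≤ 2 / S + 4 / S ^ 2 := by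
  have hS0 : 0 < S := by linarith
  have h := mul_le_mul_of_nonneg_left (log_one_sub_le (y := 2 / S) (by positivity)
    ((div_lt_one hS0).2 hS)) (sub_nonneg.2 hS.le)
  have e : (S - 2) * (-(2 / S) - (2 / S) ^ 2 / 2) = -2 + 2 / S + 4 / S ^ 2 := by
    field_simp
    ring
  linarith

lemma le_mul_log_one_sub {S : ℝ} (hS : 2 < S) : 0 ≤ (S - 2) * Real.log (1 - 2 / S) + 2 := by
  have hS0 : 0 < S := by linarith
  have hp : 0 < 1 - 2 / S := by rw [sub_pos, div_lt_one hS0]; exact hS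
  have h := mul_le_mul_of_nonneg_left (Real.one_sub_inv_le_log_of_pos hp) (sub_nonneg.2 hS.le)
  have e : (S - 2) * (1 - (1 - 2 / S)⁻¹) = -2 := by
    have : 1 - 2 / S = (S - 2) / S := by field_simp
    have : S - 2 ≠ 0 := by linarith
    rw [‹1 - 2 / S = _›, inv_div]
    field_simp
    ring
  linarith

lemma log_ratio_le_near {μ S T : ℝ} (hμ1 : 1.612 < μ) (hμ2 : μ < 1.62) (hS : 10000 ≤ S) :
    2 * (T / μ - 3 / (μ * S)) + (2 / S + 4 / S ^ 2) - S * (T ^ 2 / 2) + 0.53 / S ≤ -(3 / 10 / S) := by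
  have hS0 : 0 < S := by linarith
  have hμ : 0 < μ := by linarith
  have h1 : 0 ≤ S / 2 * (T - 2 / (μ * S)) ^ 2 := by positivity
  have e : S / 2 * (T - 2 / (μ * S)) ^ 2 = S * (T ^ 2 / 2) - 2 * (T / μ) + 2 / μ ^ 2 / S := by
    field_simp
    ring
  have h2 : 2 / μ ^ 2 ≤ 0.78 := by
    rw [div_le_iff₀ (by positivity)]
    nlinarith
  have h3 : 3.7 ≤ 6 / μ := by
    rw [le_div_iff₀ hμ]; linarith
  have e4 : 4 / S ^ 2 = 4 / S / S := by field_simp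
  have h4 : 4 / S ≤ 0.001 := by rw [div_le_iff₀ hS0]; linarith
  have h5 : (2 / μ ^ 2 - 6 / μ + 2 + 4 / S + 0.53 + 0.3) / S ≤ 0 :=
    div_nonpos_of_nonpos_of_nonneg (by linarith) hS0.le
  have e5 : (2 / μ ^ 2 - 6 / μ + 2 + 4 / S + 0.53 + 0.3) / S = 2 / μ ^ 2 / S - 2 * (3 / (μ * S)) +
      2 / S + 4 / S / S + 0.53 / S + 3 / 10 / S := by
    field_simp
    ring
  linarith

lemma log_ratio_le_far {μ S T : ℝ} (hμ1 : 1.612 < μ) (hS : 10000 ≤ S) (hT : 1 / 50 < T) :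
    2 * (T / μ - 3 / (μ * S)) + (2 / S + 4 / S ^ 2) - S * (T ^ 2 / 2) + 1 / 4 ≤ -(3 / 10 / S) := by
  have hS0 : 0 < S := by linarith
  have hμ : 0 < μ := by linarith
  have h1 : T / μ ≤ T := div_le_self (by linarith) (by linarith)
  have h2 : 0 ≤ 3 / (μ * S) := by positivity
  have h3 : 2 / S ≤ 0.001 := by rw [div_le_iff₀ hS0]; linarith
  have h4 : 3 / 10 / S ≤ 0.001 := by rw [div_le_iff₀ hS0]; linarith
  have h5 : 4 / S ^ 2 ≤ 0.001 := by rw [div_le_iff₀ (by positivity)]; nlinarith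
  have h6 : 10000 * (T ^ 2 / 2) ≤ S * (T ^ 2 / 2) := by gcongr
  nlinarith

set_option maxHeartbeats 1000000 in
lemma wt_le {α : ℝ} (hα : α ^ 3 - α ^ 2 - α - 1 = 0) {a b c n : ℕ} (hn : a + 2 * b + 3 * c = n)
    (hn0 : 30000 ≤ n) : wt a b c ≤ mainTerm α n * (1 - 1 / 10 / n) := by
  obtain ⟨A, hA⟩ : ∃ A : ℝ, A = a + 1 / 2 := ⟨_, rfl⟩
  obtain ⟨B, hB⟩ : ∃ B : ℝ, B = b + 1 / 2 := ⟨_, rfl⟩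
  obtain ⟨C, hC⟩ : ∃ C : ℝ, C = c + 1 / 2 := ⟨_, rfl⟩
  obtain ⟨S, hS⟩ : ∃ S : ℝ, S = A + B + C := ⟨_, rfl⟩
  have hα1 := lt_root hα
  have h0 : 0 < α := by linarith
  obtain ⟨hμ1, hμ2⟩ := meanIdx_bounds hα
  obtain ⟨hw, hS2, hlog⟩ := log_wt_div (show 1 < α by linarith) hn (by omega) hA hB hC hS
  have hA0 : 1 / 2 ≤ A := by rw [hA]; simp
  have hB0 : 1 / 2 ≤ B := by rw [hB]; simp
  have hC0 : 1 / 2 ≤ C := by rw [hC]; simp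
  have hent := le_relEnt hα hS (by linarith) (by linarith) (by linarith)
  have hn' : (a + 2 * b + 3 * c : ℝ) = n := by exact_mod_cast hn
  have hnr : (30000 : ℝ) ≤ n := by exact_mod_cast hn0
  have hn3 : (n : ℝ) = A + 2 * B + 3 * C - 3 := by rw [← hn', hA, hB, hC]; ring
  have hS4 : 10000 ≤ S := by linarith
  have hSn : S ≤ 2 * n := by linarith
  have hS0 : 0 < S := by linarith
  have hμ0 : 0 < meanIdx α := by linarith
  have hnS : n / S ≤ meanIdx α +
      (|A / S - 1 / α| + |B / S - 1 / α ^ 2| + |C / S - 1 / α ^ 3|) - 3 / S := by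
    have e : (n : ℝ) / S = A / S + 2 * (B / S) + 3 * (C / S) - 3 / S := by
      rw [hn3]; field_simp
    have e2 : meanIdx α = 1 / α + 2 * (1 / α ^ 2) + 3 * (1 / α ^ 3) := by unfold meanIdx; ring
    have e3 : A / S + B / S + C / S = 1 := by rw [← add_div, ← add_div, ← hS, div_self hS0.ne']
    have e4 := inv_root_sum hα
    have := neg_abs_le (A / S - 1 / α)
    have := le_abs_self (C / S - 1 / α ^ 3)
    have := abs_nonneg (B / S - 1 / α ^ 2)
    linarith
  obtain ⟨T, hT⟩ : ∃ T : ℝ, T = |A / S - 1 / α| + |B / S - 1 / α ^ 2| + |C / S - 1 / α ^ 3| := ⟨_, rfl⟩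
  rw [← hT] at hent hnS
  have hl1 : Real.log (n / (meanIdx α * S)) ≤ T / meanIdx α - 3 / (meanIdx α * S) := by
    refine (Real.log_le_sub_one_of_pos (by positivity)).trans ?_
    have : (n : ℝ) / (meanIdx α * S) = n / S / meanIdx α := by field_simp
    rw [this]
    have h := div_le_div_of_nonneg_right hnS hμ0.le
    have e : (meanIdx α + T - 3 / S) / meanIdx α = 1 + T / meanIdx α - 3 / (meanIdx α * S) := by
      field_simp
    linarith
  have hl2 := mul_log_one_sub_le hS2
  have s1 := stirlingErr_nonpos (a + b + c - 1)
  have s2 := neg_le_stirlingErr a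
  have s3 := neg_le_stirlingErr b
  have s4 := neg_le_stirlingErr c
  rw [← hA] at s2
  rw [← hB] at s3
  rw [← hC] at s4
  have key : Real.log (wt a b c / mainTerm α n) ≤ -(3 / 10 / S) := by
    by_cases hT1 : T ≤ 1 / 50
    · have := log_ratio_le_near (T := T) hμ1 hμ2 hS4
      obtain ⟨⟨h1, h2⟩, ⟨h3, h4⟩, h5, h6⟩ := inv_root_bounds hα
      have := neg_abs_le (A / S - 1 / α)
      have := abs_nonneg (A / S - 1 / α)
      have := neg_abs_le (B / S - 1 / α ^ 2)
      have := abs_nonneg (B / S - 1 / α ^ 2)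
      have := neg_abs_le (C / S - 1 / α ^ 3)
      have := abs_nonneg (C / S - 1 / α ^ 3)
      have r : ∀ X k : ℝ, 0 < X → 0 < k → k ≤ X / S → 1 / (24 * X) ≤ 1 / (24 * k) / S := by
        intro X k hX hk h
        rw [le_div_iff₀ hS0] at h
        rw [div_div]
        apply one_div_le_one_div_of_le (by positivity)
        linarith
      have r1 := r A 0.523 (by linarith) (by norm_num) (by linarith)
      have r2 := r B 0.275 (by linarith) (by norm_num) (by linarith)
      have r3 := r C 0.14 (by linarith) (by norm_num) (by linarith)
      have : 1 / (24 * 0.523) / S + 1 / (24 * 0.275) / S + 1 / (24 * 0.14) / S ≤ 0.53 / S := by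
        rw [← add_div, ← add_div]
        gcongr
        norm_num
      linarith
    · have := log_ratio_le_far hμ1 hS4 (not_le.1 hT1)
      have r : ∀ X : ℝ, 1 / 2 ≤ X → 1 / (24 * X) ≤ 1 / 12 := by
        intro X hX
        apply one_div_le_one_div_of_le (by positivity)
        linarith
      have r1 := r A hA0
      have r2 := r B hB0
      have r3 := r C hC0
      linarith
  have hm : 0 < mainTerm α n := by unfold mainTerm; positivity
  have hnp : (0 : ℝ) < n := by linarith
  have key2 : Real.log (wt a b c / mainTerm α n) ≤ -(3 / 20 / n) := by
    have : 3 / 20 / (n : ℝ) ≤ 3 / 10 / S := by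
      rw [div_le_div_iff₀ hnp hS0]; linarith
    linarith
  have key3 := Real.exp_le_exp.2 key2
  rw [Real.exp_log (by positivity), div_le_iff₀ hm, mul_comm] at key3
  refine key3.trans (mul_le_mul_of_nonneg_left ?_ hm.le)
  rw [Real.exp_neg]
  have h1 := Real.add_one_le_exp (3 / 20 / (n : ℝ))
  have hx : 3 / 20 / (n : ℝ) ≤ 1 / 3 := by rw [div_le_iff₀ hnp]; linarith
  have hx0 : 0 < 3 / 20 / (n : ℝ) := by positivity
  have e : 1 / 10 / (n : ℝ) = 2 / 3 * (3 / 20 / n) := by ring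
  rw [e]
  refine (inv_anti₀ (by positivity) h1).trans ?_
  rw [inv_le_iff_one_le_mul₀ (by positivity)]
  nlinarith only [hx, hx0]

set_option maxHeartbeats 1000000 in
lemma exists_le_wt {α : ℝ} (hα : α ^ 3 - α ^ 2 - α - 1 = 0) {n : ℕ} (hn0 : 3 ≤ n) :
    ∃ a b c : ℕ, a + 2 * b + 3 * c = n ∧ mainTerm α n * (1 - 15000 / n) ≤ wt a b c := by
  have hα1 := lt_root hα
  have hα2 := root_lt hα
  have h0 : 0 < α := by linarith
  obtain ⟨hμ1, hμ2⟩ := meanIdx_bounds hα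
  have hμ0 : 0 < meanIdx α := by linarith
  have hnr : (3 : ℝ) ≤ n := by exact_mod_cast hn0
  obtain ⟨t, ht⟩ : ∃ t : ℝ, t = n / meanIdx α := ⟨_, rfl⟩
  have ht0 : 0 < t := by rw [ht]; positivity
  have htn : t * meanIdx α = n := by rw [ht]; field_simp
  have eμ : meanIdx α = 1 / α + 2 * (1 / α ^ 2) + 3 * (1 / α ^ 3) := by unfold meanIdx; ring
  obtain ⟨b, hb⟩ : ∃ b : ℕ, b = ⌊t * (1 / α ^ 2)⌋₊ := ⟨_, rfl⟩
  obtain ⟨c, hc⟩ : ∃ c : ℕ, c = ⌊t * (1 / α ^ 3)⌋₊ := ⟨_, rfl⟩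
  have b1 : (b : ℝ) ≤ t * (1 / α ^ 2) := hb ▸ Nat.floor_le (by positivity)
  have b2 : t * (1 / α ^ 2) < b + 1 := hb ▸ Nat.lt_floor_add_one _
  have c1 : (c : ℝ) ≤ t * (1 / α ^ 3) := hc ▸ Nat.floor_le (by positivity)
  have c2 : t * (1 / α ^ 3) < c + 1 := hc ▸ Nat.lt_floor_add_one _
  have hle : 2 * b + 3 * c ≤ n := by
    have : (2 * b + 3 * c : ℝ) ≤ n := by
      rw [← htn, eμ]
      have : 0 < t * (1 / α) := by positivity
      linarith
    exact_mod_cast this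
  obtain ⟨a, ha⟩ := Nat.exists_eq_add_of_le hle
  have hn : a + 2 * b + 3 * c = n := by omega
  refine ⟨a, b, c, hn, ?_⟩
  obtain ⟨A, hA⟩ : ∃ A : ℝ, A = a + 1 / 2 := ⟨_, rfl⟩
  obtain ⟨B, hB⟩ : ∃ B : ℝ, B = b + 1 / 2 := ⟨_, rfl⟩
  obtain ⟨C, hC⟩ : ∃ C : ℝ, C = c + 1 / 2 := ⟨_, rfl⟩
  obtain ⟨S, hS⟩ : ∃ S : ℝ, S = A + B + C := ⟨_, rfl⟩
  obtain ⟨hw, hS2, hlog⟩ := log_wt_div (show 1 < α by linarith) hn (by omega) hA hB hC hS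
  have hA0 : 1 / 2 ≤ A := by rw [hA]; simp
  have hB0 : 1 / 2 ≤ B := by rw [hB]; simp
  have hC0 : 1 / 2 ≤ C := by rw [hC]; simp
  have hent := relEnt_le hα hS (by linarith) (by linarith) (by linarith)
  have hn' : (a + 2 * b + 3 * c : ℝ) = n := by exact_mod_cast hn
  have hn3 : (n : ℝ) = A + 2 * B + 3 * C - 3 := by rw [← hn', hA, hB, hC]; ring
  have hS0 : 0 < S := by linarith
  have hnp : (0 : ℝ) < n := by linarith
  have hSn : n / 3 ≤ S := by linarith
  have a1 : t * (1 / α) ≤ a ∧ a ≤ t * (1 / α) + 5 := by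
    have : t * (1 / α) + 2 * (t * (1 / α ^ 2)) + 3 * (t * (1 / α ^ 3)) = a + 2 * b + 3 * c := by
      rw [hn', ← htn, eμ]; ring
    constructor <;> linarith
  have es := inv_root_sum hα
  have hSt : t - 2 ≤ S ∧ S ≤ t + 7 := by
    have : t = t * (1 / α) + t * (1 / α ^ 2) + t * (1 / α ^ 3) := by
      rw [← mul_add, ← mul_add, es, mul_one]
    constructor <;> linarith
  have hl1 : -(24 / n) ≤ 2 * Real.log (n / (meanIdx α * S)) := by
    have h := Real.one_sub_inv_le_log_of_pos (show 0 < n / (meanIdx α * S) by positivity)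
    rw [inv_div] at h
    have : meanIdx α * S / n ≤ 1 + 12 / n := by
      rw [show 1 + 12 / (n : ℝ) = (n + 12) / n by field_simp]
      gcongr
      have := mul_le_mul_of_nonneg_left hSt.2 hμ0.le
      have e2 : meanIdx α * (t + 7) = t * meanIdx α + 7 * meanIdx α := by ring
      linarith only [this, e2, htn, hμ2]
    have e : (24 : ℝ) / n = 2 * (12 / n) := by ring
    linarith
  have hl2 := le_mul_log_one_sub hS2
  have s1 := neg_le_stirlingErr (a + b + c - 1)
  rw [Nat.cast_sub (by omega)] at s1
  push_cast at s1
  rw [show ((a : ℝ) + b + c - 1 + 1 / 2) = S - 2 by rw [hS, hA, hB, hC]; ring] at s1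
  have s1' : 1 / (24 * (S - 2)) ≤ 1 / n := by
    apply one_div_le_one_div_of_le hnp
    have : S - 2 ≥ n / 3 - 1 / 2 - 1 / 2 + 1 / 2 := by linarith
    linarith
  have s2 := stirlingErr_nonpos a
  have s3 := stirlingErr_nonpos b
  have s4 := stirlingErr_nonpos c
  obtain ⟨⟨p1, p1'⟩, ⟨p2, p2'⟩, p3, p3'⟩ := inv_root_bounds hα
  have dev : ∀ X p : ℝ, 0 ≤ p → p ≤ 1 → |X - t * p| ≤ 6 → (X / S - p) ^ 2 ≤ (20 / S) ^ 2 := by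
    intro X p hp0 hp1 h
    rw [abs_le] at h
    have e : X / S - p = (X - S * p) / S := by field_simp
    have k1 : (t - 2) * p ≤ S * p := by gcongr; exact hSt.1
    have k2 : S * p ≤ (t + 7) * p := by gcongr; exact hSt.2
    rw [e]
    apply sq_le_sq'
    · rw [← neg_div]
      exact div_le_div_of_nonneg_right (by linarith only [h.1, h.2, k1, k2, hp0, hp1]) hS0.le
    · exact div_le_div_of_nonneg_right (by linarith only [h.1, h.2, k1, k2, hp0, hp1]) hS0.le
  have d1 := dev A (1 / α) (by linarith) (by linarith) (by rw [abs_le]; constructor <;> linarith)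
  have d2 := dev B (1 / α ^ 2) (by linarith) (by linarith) (by rw [abs_le]; constructor <;> linarith)
  have d3 := dev C (1 / α ^ 3) (by linarith) (by linarith) (by rw [abs_le]; constructor <;> linarith)
  have q2 : α ^ 2 ≤ 1.84 ^ 2 := by gcongr
  have q3 : α ^ 3 ≤ 1.84 ^ 3 := by gcongr
  have hr : relEnt α A B C ≤ 4680 / S := by
    refine hent.trans ?_
    have : (A / S - 1 / α) ^ 2 * α + (B / S - 1 / α ^ 2) ^ 2 * α ^ 2 +
      (C / S - 1 / α ^ 3) ^ 2 * α ^ 3 ≤ (20 / S) ^ 2 * 1.84 + (20 / S) ^ 2 * 1.84 ^ 2 +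
        (20 / S) ^ 2 * 1.84 ^ 3 := by gcongr
    have e : (20 / S) ^ 2 * 1.84 + (20 / S) ^ 2 * 1.84 ^ 2 + (20 / S) ^ 2 * 1.84 ^ 3 ≤
      4680 / S ^ 2 := by
      rw [div_pow, show (4680 : ℝ) / S ^ 2 = 20 ^ 2 / S ^ 2 * 11.7 by ring]
      have : 0 < (20 : ℝ) ^ 2 / S ^ 2 := by positivity
      linarith only [this]
    refine (mul_le_mul_of_nonneg_left (this.trans e) hS0.le).trans (le_of_eq ?_)
    field_simp
  have hr2 : 4680 / S ≤ 14040 / n := by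
    have : 4680 / S ≤ 4680 / (n / 3) := by gcongr
    refine this.trans (le_of_eq ?_)
    field_simp
    norm_num
  have key : -(15000 / n) ≤ Real.log (wt a b c / mainTerm α n) := by
    have : (15000 : ℝ) / n = 14040 / n + 24 / n + 1 / n + 935 / n := by ring
    have : (0 : ℝ) < 935 / n := by positivity
    linarith
  have hm : 0 < mainTerm α n := by unfold mainTerm; positivity
  rw [mul_comm, ← le_div_iff₀ hm]
  have := Real.add_one_le_exp (Real.log (wt a b c / mainTerm α n))
  rw [Real.exp_log (by positivity)] at this
  linarith

/-- All the coefficients of `P` are at most `B` in absolute value. -/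
def CoeffBound (P : MvPolynomial (Fin 4) ℤ) (B : ℝ) : Prop := ∀ u, |signedCoeff P u| ≤ B

/-- All the signed coefficients of `P` lie in `[0, B]`. -/
def SignedBound (P : MvPolynomial (Fin 4) ℤ) (B : ℝ) : Prop :=
  ∀ u, 0 ≤ signedCoeff P u ∧ signedCoeff P u ≤ B

lemma SignedBound.coeffBound {P : MvPolynomial (Fin 4) ℤ} {B : ℝ} (h : SignedBound P B) :
    CoeffBound P B := fun u => by
  rw [abs_of_nonneg (h u).1]; exact (h u).2

lemma SignedBound.nonneg {P : MvPolynomial (Fin 4) ℤ} {B : ℝ} (h : SignedBound P B) : 0 ≤ B :=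
  (h 0).1.trans (h 0).2

lemma CoeffBound.nonneg {P : MvPolynomial (Fin 4) ℤ} {B : ℝ} (h : CoeffBound P B) : 0 ≤ B :=
  (abs_nonneg _).trans (h 0)

lemma CoeffBound.mono {P : MvPolynomial (Fin 4) ℤ} {B B' : ℝ} (h : CoeffBound P B) (hB : B ≤ B') :
    CoeffBound P B' := fun u => (h u).trans hB

lemma SignedBound.add {P Q : MvPolynomial (Fin 4) ℤ} {B C : ℝ} (h : SignedBound P B)
    (h' : SignedBound Q C) : SignedBound (P + Q) (B + C) := fun u => by
  rw [signedCoeff_add]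
  exact ⟨add_nonneg (h u).1 (h' u).1, add_le_add (h u).2 (h' u).2⟩

lemma SignedBound.natCast_mul {P : MvPolynomial (Fin 4) ℤ} {B : ℝ} (h : SignedBound P B) (k : ℕ) :
    SignedBound (k * P) (k * B) := by
  induction k with
  | zero => intro u; simp [signedCoeff]
  | succ k ih =>
    push_cast
    rw [add_one_mul, add_one_mul]
    exact ih.add h

lemma SignedBound.X_mul {P : MvPolynomial (Fin 4) ℤ} {B : ℝ} (h : SignedBound P B) :
    SignedBound (X 3 * P) B := fun u => by
  rw [signedCoeff_X_mul]
  split_ifs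
  · exact ⟨le_rfl, h.nonneg⟩
  · exact h _

lemma SignedBound.neg_X_mul {P : MvPolynomial (Fin 4) ℤ} {B : ℝ} (h : SignedBound P B) {i : Fin 4}
    (hi : i ≠ 3) : SignedBound (-X i * P) B := fun u => by
  rw [signedCoeff_neg_X_mul _ _ hi]
  split_ifs
  · exact ⟨le_rfl, h.nonneg⟩
  · exact h _

lemma SignedBound.sub {P Q : MvPolynomial (Fin 4) ℤ} {B C : ℝ} (h : SignedBound P B)
    (h' : SignedBound Q C) : CoeffBound (P - Q) (max B C) := fun u => by
  rw [signedCoeff_sub, abs_le]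
  have := h u
  have := h' u
  have := le_max_left B C
  have := le_max_right B C
  constructor <;> linarith

lemma CoeffBound.X_mul {P : MvPolynomial (Fin 4) ℤ} {B : ℝ} (h : CoeffBound P B) :
    CoeffBound (X 3 * P) B := fun u => by
  rw [signedCoeff_X_mul]
  split_ifs
  · simpa using h.nonneg
  · exact h _

lemma CoeffBound.neg_X_mul {P : MvPolynomial (Fin 4) ℤ} {B : ℝ} (h : CoeffBound P B) {i : Fin 4}
    (hi : i ≠ 3) : CoeffBound (-X i * P) B := fun u => by
  rw [signedCoeff_neg_X_mul _ _ hi]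
  split_ifs
  · simpa using h.nonneg
  · exact h _

lemma CoeffBound.neg {P : MvPolynomial (Fin 4) ℤ} {B : ℝ} (h : CoeffBound P B) :
    CoeffBound (-P) B := fun u => by
  have := h u
  rwa [show signedCoeff (-P) u = -signedCoeff P u by simp [signedCoeff], abs_neg]

lemma CoeffBound.monomial_mul {P : MvPolynomial (Fin 4) ℤ} {B : ℝ} (h : CoeffBound P B) (i e : ℕ) :
    CoeffBound ((-X 0) ^ i * (X 3 ^ e * P)) B := by
  have h1 : CoeffBound (X 3 ^ e * P) B := by
    induction e with
    | zero => simpa using h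
    | succ e ih => rw [pow_succ', mul_assoc]; exact ih.X_mul
  induction i with
  | zero => simpa using h1
  | succ i ih => rw [pow_succ', mul_assoc]; exact ih.neg_X_mul (by decide)

lemma CoeffBound.sgn_mul {P : MvPolynomial (Fin 4) ℤ} {B : ℝ} (h : CoeffBound P B) (n : ℕ) :
    CoeffBound (sgn n * P) B := by
  rcases neg_one_pow_eq_or (MvPolynomial (Fin 4) ℤ) (n * 3) with h1 | h1
  · rw [sgn, h1, one_mul]; exact h
  · rw [sgn, h1, neg_one_mul]; exact h.neg

lemma signedBound_powSum {k : ℕ} {W : ℝ} (hW : 0 ≤ W)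
    (h : ∀ a b c : ℕ, a + 2 * b + 3 * c = k → wt a b c ≤ W) : SignedBound (powSum k) W := fun u => by
  rw [signedCoeff_powSum]
  split_ifs with hu
  · exact ⟨wt_nonneg _ _ _, h _ _ _ hu.1⟩
  · exact ⟨le_rfl, hW⟩

lemma coeffBound_gCoeff_one {n : ℕ} (i : Fin (n + 1)) :
    CoeffBound (gCoeff n (Finsupp.single i 1 + Finsupp.single i 1 + Finsupp.single i 1)) 1 := by
  rw [gCoeff_one]
  refine CoeffBound.sgn_mul (CoeffBound.monomial_mul (fun u => ?_) _ _) _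
  rw [abs_signedCoeff, coeff_one]
  split_ifs <;> simp

lemma coeffBound_gCoeff_two {n : ℕ} {i k : Fin (n + 1)} (hik : i < k) {W : ℝ}
    (h : SignedBound (powSum (k - i)) W) :
    CoeffBound (gCoeff n (Finsupp.single i 1 + Finsupp.single i 1 + Finsupp.single k 1)) W := by
  rw [gCoeff_two hik]
  exact (h.coeffBound.monomial_mul _ _).sgn_mul _

lemma coeffBound_gCoeff_succ {n : ℕ} {i j k : Fin (n + 1)} (hij : (j : ℕ) = i + 1) (p : ℕ)
    (hk : (k : ℕ) = i + p + 2) {W W' : ℝ} (h : SignedBound (powSum (p + 1)) W)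
    (h' : SignedBound (powSum p) W') :
    CoeffBound (gCoeff n (Finsupp.single i 1 + Finsupp.single j 1 + Finsupp.single k 1)) (W + W') := by
  rw [gCoeff_succ hij p hk]
  refine CoeffBound.sgn_mul (CoeffBound.monomial_mul (CoeffBound.neg (SignedBound.coeffBound ?_)) _ _) _
  exact (h.neg_X_mul (by decide)).add (h'.X_mul.neg_X_mul (by decide))

lemma coeffBound_gCoeff_add_three {n : ℕ} {i j k : Fin (n + 1)} (hij : (j : ℕ) = i + 3) (p : ℕ)
    (hk : (k : ℕ) = i + p + 5) {W W' W'' : ℝ} (h : SignedBound (powSum (p + 2)) W)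
    (h' : SignedBound (powSum (p + 1)) W') (h'' : SignedBound (powSum p) W'') :
    CoeffBound (gCoeff n (Finsupp.single i 1 + Finsupp.single j 1 + Finsupp.single k 1))
      (2 * W + 3 * W + W' + W'') := by
  rw [gCoeff_add_three hij p hk]
  refine CoeffBound.sgn_mul (CoeffBound.monomial_mul ?_ _ _) _
  have h0 : (0 : Fin 4) ≠ 3 := by decide
  have h1 : (1 : Fin 4) ≠ 3 := by decide
  have h2 : (2 : Fin 4) ≠ 3 := by decide
  refine (SignedBound.sub (((((h.X_mul.neg_X_mul h0).neg_X_mul h0).natCast_mul 2).add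
    ((((h.neg_X_mul h0).neg_X_mul h1).neg_X_mul h2).natCast_mul 3)).add
    (((h'.X_mul.neg_X_mul h0).neg_X_mul h0).neg_X_mul h2) |>.add
    (((h''.X_mul.X_mul.neg_X_mul h0).neg_X_mul h0).neg_X_mul h1))
    (((h.neg_X_mul h1).neg_X_mul h1).neg_X_mul h1)).mono ?_
  have := h.nonneg
  have := h'.nonneg
  have := h''.nonneg
  apply max_le
  · push_cast; linarith
  · linarith

lemma HasRoots.rev {f : Fin 4 → ℂ} {ρ : Fin 3 → ℂ} (h : HasRoots f ρ) (h0 : f 0 ≠ 0) :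
    HasRoots (f ∘ Fin.rev) (fun i => (ρ i)⁻¹) := by
  obtain ⟨h2, h1, h00⟩ := h
  have hr : ρ 0 ≠ 0 ∧ ρ 1 ≠ 0 ∧ ρ 2 ≠ 0 := by
    refine ⟨?_, ?_, ?_⟩ <;> intro hz <;> simp [hz] at h00 <;> exact h0 h00
  obtain ⟨r0, r1, r2⟩ := hr
  refine ⟨?_, ?_, ?_⟩
  · change f 1 = -(f 0 * _)
    rw [h1, h00]; field_simp; ring
  · change f 2 = f 0 * _
    rw [h2, h00]; field_simp; ring
  · change f 3 = -(f 0 * _)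
    rw [h00]; field_simp

lemma mapDomain_rev_rev {m : ℕ} (v : Fin m →₀ ℕ) :
    Finsupp.mapDomain Fin.rev (Finsupp.mapDomain Fin.rev v) = v := by
  rw [← Finsupp.mapDomain_comp, show (Fin.rev ∘ Fin.rev : Fin m → Fin m) = id from
    funext Fin.rev_rev, Finsupp.mapDomain_id]

lemma symSum_rev {n : ℕ} (i j k : Fin (n + 1)) {ρ : Fin 3 → ℂ} (hρ : ∀ i, ρ i ≠ 0) :
    (ρ 0 * ρ 1 * ρ 2) ^ n *
      symSum n (Finsupp.single i 1 + Finsupp.single j 1 + Finsupp.single k 1) (fun i => (ρ i)⁻¹) =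
    symSum n (Finsupp.single i.rev 1 + Finsupp.single j.rev 1 + Finsupp.single k.rev 1) ρ := by
  have hp : ∀ (l : Fin 3) (a : Fin (n + 1)), ρ l ^ n * (ρ l)⁻¹ ^ (a.rev : ℕ) = ρ l ^ (a : ℕ) := by
    intro l a
    rw [Fin.val_rev, inv_pow, ← div_eq_mul_inv, div_eq_iff (pow_ne_zero _ (hρ l)), ← pow_add]
    congr 1
    omega
  have hs : ∀ a b c : Fin (n + 1), ((Finsupp.single a.rev 1 + Finsupp.single b.rev 1 +
      Finsupp.single c.rev 1 : Fin (n + 1) →₀ ℕ) =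
        Finsupp.single i 1 + Finsupp.single j 1 + Finsupp.single k 1) ↔
      ((Finsupp.single a 1 + Finsupp.single b 1 + Finsupp.single c 1 : Fin (n + 1) →₀ ℕ) =
        Finsupp.single i.rev 1 + Finsupp.single j.rev 1 + Finsupp.single k.rev 1) := by
    have hm : ∀ a b c : Fin (n + 1), Finsupp.mapDomain Fin.rev (Finsupp.single a 1 +
        Finsupp.single b 1 + Finsupp.single c 1 : Fin (n + 1) →₀ ℕ) =
        Finsupp.single a.rev 1 + Finsupp.single b.rev 1 + Finsupp.single c.rev 1 := by
      intro a b c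
      simp [Finsupp.mapDomain_add]
    intro a b c
    rw [← hm, ← hm i j k]
    constructor
    · intro h
      rw [← h, mapDomain_rev_rev]
    · intro h
      rw [h, mapDomain_rev_rev]
  simp only [symSum]
  rw [← Equiv.sum_comp Fin.revPerm, Finset.mul_sum]
  refine Finset.sum_congr rfl fun a _ => ?_
  rw [← Equiv.sum_comp Fin.revPerm, Finset.mul_sum]
  refine Finset.sum_congr rfl fun b _ => ?_
  rw [← Equiv.sum_comp Fin.revPerm, Finset.mul_sum]
  refine Finset.sum_congr rfl fun c _ => ?_
  simp only [Fin.revPerm_apply, hs]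
  split_ifs
  · rw [← hp 0 a, ← hp 1 b, ← hp 2 c]; ring
  · simp

lemma gCoeff_rev {n : ℕ} (i j k : Fin (n + 1)) :
    gCoeff n (Finsupp.single i.rev 1 + Finsupp.single j.rev 1 + Finsupp.single k.rev 1) =
      (-1) ^ n * rename Fin.rev
        (gCoeff n (Finsupp.single i 1 + Finsupp.single j 1 + Finsupp.single k 1)) := by
  apply ext_of_aeval
  intro f h0 h3
  obtain ⟨ρ, h⟩ := exists_hasRoots f h3
  have hρ : ∀ i, ρ i ≠ 0 := by
    obtain ⟨-, -, h00⟩ := h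
    intro i hi
    apply h0
    rw [h00]
    fin_cases i <;> simp at hi <;> simp [hi]
  rw [map_mul, map_pow, map_neg, map_one, aeval_rename, eval_gCoeff n _ f ρ h,
    eval_gCoeff n _ _ _ (h.rev h0), ← symSum_rev i j k hρ]
  change _ = (-1) ^ n * (_ * f 0 ^ n * _)
  rw [h.2.2, show -(f 3 * (ρ 0 * ρ 1 * ρ 2)) = (-1) * f 3 * (ρ 0 * ρ 1 * ρ 2) by ring, mul_pow, mul_pow]
  have : ((-1 : ℂ) ^ n) * (-1) ^ n = 1 := by rw [← mul_pow]; simp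
  linear_combination (-(-1 : ℂ) ^ (n * 3) * f 3 ^ n * (ρ 0 * ρ 1 * ρ 2) ^ n *
    symSum n (Finsupp.single i 1 + Finsupp.single j 1 + Finsupp.single k 1) (fun i => (ρ i)⁻¹)) * this

lemma coeffBound_gCoeff_rev {n : ℕ} {i j k : Fin (n + 1)} {B : ℝ}
    (h : CoeffBound (gCoeff n (Finsupp.single i 1 + Finsupp.single j 1 + Finsupp.single k 1)) B) :
    CoeffBound (gCoeff n (Finsupp.single i.rev 1 + Finsupp.single j.rev 1 + Finsupp.single k.rev 1)) B := by
  rw [gCoeff_rev]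
  generalize gCoeff n (Finsupp.single i 1 + Finsupp.single j 1 + Finsupp.single k 1) = P at *
  have h1 : CoeffBound (rename Fin.rev P) B := fun u => by
    have hu : u = Finsupp.mapDomain Fin.rev (Finsupp.mapDomain Fin.rev u) :=
      (mapDomain_rev_rev u).symm
    have := h (Finsupp.mapDomain Fin.rev u)
    rw [abs_signedCoeff] at this ⊢
    rwa [hu, coeff_rename_mapDomain _ Fin.rev_injective]
  rcases neg_one_pow_eq_or (MvPolynomial (Fin 4) ℤ) n with h2 | h2
  · rw [h2, one_mul]; exact h1
  · rw [h2, neg_one_mul]; exact h1.neg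

/-- The point `(ζ ^ z 0, …, ζ ^ z 3)` of the torus, where `ζ = exp (2πi / N)`. -/
def torusPoint {N : ℕ} (z : Fin 4 → Fin N) (i : Fin 4) : ℂ :=
  Complex.exp (2 * Real.pi * Complex.I / N) ^ (z i : ℕ)

/-- The average of `F` over the points of the torus all of whose coordinates are `N`-th roots of
unity. -/
def torusAvg (N : ℕ) (F : (Fin 4 → ℂ) → ℝ) : ℝ :=
  (∑ z : Fin 4 → Fin N, F (torusPoint z)) / (N : ℝ) ^ 4

lemma norm_exp_two_pi_div (N : ℕ) : ‖Complex.exp (2 * Real.pi * Complex.I / N)‖ = 1 := by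
  rw [show (2 * Real.pi * Complex.I / N : ℂ) = ((2 * Real.pi / N : ℝ) : ℂ) * Complex.I by
    push_cast; ring]
  exact Complex.norm_exp_ofReal_mul_I _

lemma norm_torusPoint {N : ℕ} (z : Fin 4 → Fin N) (i : Fin 4) : ‖torusPoint z i‖ = 1 := by
  rw [torusPoint, norm_pow, norm_exp_two_pi_div, one_pow]

lemma sum_root_pow {N : ℕ} (hN : N ≠ 0) {a b : ℕ} (ha : a < N) (hb : b < N) :
    ∑ x : Fin N, (Complex.exp (2 * Real.pi * Complex.I / N) ^ (x : ℕ)) ^ a *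
      (starRingEnd ℂ) ((Complex.exp (2 * Real.pi * Complex.I / N) ^ (x : ℕ)) ^ b) =
    if a = b then (N : ℂ) else 0 := by
  have hprim := Complex.isPrimitiveRoot_exp N hN
  have hnorm := norm_exp_two_pi_div N
  set ζ := Complex.exp (2 * Real.pi * Complex.I / N)
  have hζ : ζ ≠ 0 := by rw [← norm_ne_zero_iff, hnorm]; exact one_ne_zero
  have hconj : (starRingEnd ℂ) ζ = ζ⁻¹ := (Complex.inv_eq_conj hnorm).symm
  have h1 : ∀ x : Fin N, (ζ ^ (x : ℕ)) ^ a * (starRingEnd ℂ) ((ζ ^ (x : ℕ)) ^ b) =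
      (ζ ^ a * ζ⁻¹ ^ b) ^ (x : ℕ) := by
    intro x
    rw [map_pow, map_pow, hconj, mul_pow, ← pow_mul, ← pow_mul, ← pow_mul, ← pow_mul, mul_comm a,
      mul_comm b]
  rw [Finset.sum_congr rfl fun x _ => h1 x]
  split_ifs with hab
  · subst hab
    rw [← mul_pow, mul_inv_cancel₀ hζ]
    simp
  · rw [Fin.sum_univ_eq_sum_range (fun x => (ζ ^ a * ζ⁻¹ ^ b) ^ x)]
    have h2 : ζ ^ a * ζ⁻¹ ^ b ≠ 1 := by
      intro h
      apply hab
      apply hprim.pow_inj ha hb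
      rw [inv_pow] at h
      field_simp at h
      exact h
    have h3 : (ζ ^ a * ζ⁻¹ ^ b) ^ N = 1 := by
      rw [mul_pow, ← pow_mul, ← pow_mul, mul_comm a, mul_comm b, pow_mul, pow_mul, inv_pow,
        hprim.pow_eq_one]
      simp
    have := mul_geom_sum (ζ ^ a * ζ⁻¹ ^ b) N
    rw [h3, sub_self] at this
    exact (mul_eq_zero.1 this).resolve_left (sub_ne_zero.2 h2)

lemma sum_monomial_mul_conj {N : ℕ} (hN : N ≠ 0) {u v : Fin 4 →₀ ℕ} (hu : ∀ i, u i < N)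
    (hv : ∀ i, v i < N) :
    ∑ z : Fin 4 → Fin N, (∏ i, torusPoint z i ^ u i) *
      (starRingEnd ℂ) (∏ i, torusPoint z i ^ v i) = if u = v then (N : ℂ) ^ 4 else 0 := by
  have h1 : ∀ z : Fin 4 → Fin N, (∏ i, torusPoint z i ^ u i) *
      (starRingEnd ℂ) (∏ i, torusPoint z i ^ v i) = ∏ i,
        ((Complex.exp (2 * Real.pi * Complex.I / N) ^ (z i : ℕ)) ^ u i *
      (starRingEnd ℂ) ((Complex.exp (2 * Real.pi * Complex.I / N) ^ (z i : ℕ)) ^ v i)) := by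
    intro z
    rw [map_prod, ← Finset.prod_mul_distrib]
    rfl
  rw [Finset.sum_congr rfl fun z _ => h1 z]
  have h2 := Finset.prod_univ_sum (fun _ : Fin 4 => (Finset.univ : Finset (Fin N)))
    (fun i (x : Fin N) => (Complex.exp (2 * Real.pi * Complex.I / N) ^ (x : ℕ)) ^ u i *
      (starRingEnd ℂ) ((Complex.exp (2 * Real.pi * Complex.I / N) ^ (x : ℕ)) ^ v i))
  rw [Fintype.piFinset_univ] at h2
  rw [← h2, Finset.prod_congr rfl fun i _ => sum_root_pow hN (hu i) (hv i)]
  split_ifs with huv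
  · subst huv
    simp
  · have : ∃ i, u i ≠ v i := by
      by_contra! h
      exact huv (Finsupp.ext h)
    obtain ⟨i, hi⟩ := this
    exact Finset.prod_eq_zero (Finset.mem_univ i) (if_neg hi)

lemma sum_aeval_mul_conj {N : ℕ} (hN : N ≠ 0) {P : MvPolynomial (Fin 4) ℤ}
    (hP : ∀ v ∈ P.support, ∀ i, v i < N) {u : Fin 4 →₀ ℕ} (hu : ∀ i, u i < N) :
    ∑ z : Fin 4 → Fin N, aeval (torusPoint z) P * (starRingEnd ℂ) (∏ i, torusPoint z i ^ u i) =
      ((coeff u P : ℤ) : ℂ) * (N : ℂ) ^ 4 := by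
  simp only [aeval_def, eval₂_eq', Finset.sum_mul]
  rw [Finset.sum_comm]
  have : ∀ v ∈ P.support, ∑ z : Fin 4 → Fin N, (algebraMap ℤ ℂ) (coeff v P) * (∏ i, torusPoint z i ^ v i) *
      (starRingEnd ℂ) (∏ i, torusPoint z i ^ u i) = if v = u then ((coeff u P : ℤ) : ℂ) * (N : ℂ) ^ 4 else 0 := by
    intro v hv
    simp only [mul_assoc]
    rw [← Finset.mul_sum, sum_monomial_mul_conj hN (hP v hv) hu]
    split_ifs with h
    · rw [h]; rfl
    · simp
  rw [Finset.sum_congr rfl this, Finset.sum_ite_eq']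
  split_ifs with h
  · rfl
  · rw [notMem_support_iff.1 h]; simp

lemma abs_coeff_le_torusAvg {N : ℕ} (hN : N ≠ 0) {P : MvPolynomial (Fin 4) ℤ}
    (hP : ∀ v ∈ P.support, ∀ i, v i < N) (u : Fin 4 →₀ ℕ) :
    |((coeff u P : ℤ) : ℝ)| ≤ torusAvg N (fun f => ‖aeval f P‖) := by
  have hN4 : (0 : ℝ) < (N : ℝ) ^ 4 := by positivity
  by_cases hu : u ∈ P.support
  · rw [torusAvg, le_div_iff₀ hN4]
    have h1 := sum_aeval_mul_conj hN hP (hP u hu)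
    calc |((coeff u P : ℤ) : ℝ)| * (N : ℝ) ^ 4 = ‖((coeff u P : ℤ) : ℂ) * (N : ℂ) ^ 4‖ := by simp
      _ ≤ ∑ z : Fin 4 → Fin N, ‖aeval (torusPoint z) P * (starRingEnd ℂ) (∏ i, torusPoint z i ^ u i)‖ := by
          rw [← h1]; exact norm_sum_le _ _
      _ = _ := by
          refine Finset.sum_congr rfl fun z _ => ?_
          simp [norm_torusPoint]
  · rw [notMem_support_iff.1 hu]
    simp only [Int.cast_zero, abs_zero]
    exact div_nonneg (Finset.sum_nonneg fun _ _ => norm_nonneg _) hN4.le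

lemma torusAvg_norm_sq {N : ℕ} (hN : N ≠ 0) {P : MvPolynomial (Fin 4) ℤ}
    (hP : ∀ v ∈ P.support, ∀ i, v i < N) :
    torusAvg N (fun f => ‖aeval f P‖ ^ 2) = ∑ u ∈ P.support, ((coeff u P : ℤ) : ℝ) ^ 2 := by
  have hN4 : (N : ℝ) ^ 4 ≠ 0 := by positivity
  rw [torusAvg, div_eq_iff hN4]
  have key : (∑ z : Fin 4 → Fin N, ((‖aeval (torusPoint z) P‖ ^ 2 : ℝ) : ℂ)) =
      ∑ u ∈ P.support, ((coeff u P : ℤ) : ℂ) ^ 2 * (N : ℂ) ^ 4 := by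
    have h1 : ∀ z : Fin 4 → Fin N, ((‖aeval (torusPoint z) P‖ ^ 2 : ℝ) : ℂ) =
        ∑ u ∈ P.support, ((coeff u P : ℤ) : ℂ) *
          (aeval (torusPoint z) P * (starRingEnd ℂ) (∏ i, torusPoint z i ^ u i)) := by
      intro z
      have h2 : (starRingEnd ℂ) (aeval (torusPoint z) P) =
          ∑ u ∈ P.support, ((coeff u P : ℤ) : ℂ) * (starRingEnd ℂ) (∏ i, torusPoint z i ^ u i) := by
        rw [aeval_def, eval₂_eq', map_sum]
        refine Finset.sum_congr rfl fun u _ => ?_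
        rw [map_mul]
        simp
      push_cast
      rw [← Complex.mul_conj', h2, Finset.mul_sum]
      exact Finset.sum_congr rfl fun u _ => by ring
    rw [Finset.sum_congr rfl fun z _ => h1 z, Finset.sum_comm]
    refine Finset.sum_congr rfl fun u hu => ?_
    rw [← Finset.mul_sum, sum_aeval_mul_conj hN hP (hP u hu)]
    ring
  rw [Finset.sum_mul]
  exact_mod_cast key

lemma torusAvg_mono {N : ℕ} {F G : (Fin 4 → ℂ) → ℝ}
    (h : ∀ f : Fin 4 → ℂ, (∀ i, ‖f i‖ = 1) → F f ≤ G f) : torusAvg N F ≤ torusAvg N G := by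
  apply div_le_div_of_nonneg_right _ (by positivity)
  exact Finset.sum_le_sum fun z _ => h _ (norm_torusPoint z)

lemma torusAvg_linear {N : ℕ} (hN : N ≠ 0) (F G : (Fin 4 → ℂ) → ℝ) (a b c : ℝ) :
    torusAvg N (fun f => a * F f + b * G f + c) = a * torusAvg N F + b * torusAvg N G + c := by
  have hN' : (N : ℝ) ≠ 0 := by positivity
  simp only [torusAvg, Finset.sum_add_distrib, ← Finset.mul_sum]
  simp
  field_simp

lemma exists_degree_bound (s : Finset (Fin 4 →₀ ℕ)) : ∃ N : ℕ, ∀ v ∈ s, ∀ i, v i < N := by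
  refine ⟨(s.sup fun v => Finset.univ.sup v) + 1, fun v hv i => Nat.lt_succ_of_le ?_⟩
  exact (Finset.le_sup (f := v) (Finset.mem_univ i)).trans
    (Finset.le_sup (f := fun v : Fin 4 →₀ ℕ => Finset.univ.sup v) hv)

/-- A pointwise bound for `P` on the torus in terms of `‖Q‖²` and `‖R‖²` yields a bound for the
coefficients of `P` in terms of those of `Q` and `R`. -/
lemma abs_coeff_le_of_torus {P Q R : MvPolynomial (Fin 4) ℤ} {a b c : ℝ}
    (h : ∀ f : Fin 4 → ℂ, (∀ i, ‖f i‖ = 1) →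
      ‖aeval f P‖ ≤ a * ‖aeval f Q‖ ^ 2 + b * ‖aeval f R‖ ^ 2 + c) (u : Fin 4 →₀ ℕ) :
    |((coeff u P : ℤ) : ℝ)| ≤ a * ∑ v ∈ Q.support, ((coeff v Q : ℤ) : ℝ) ^ 2 +
      b * ∑ v ∈ R.support, ((coeff v R : ℤ) : ℝ) ^ 2 + c := by
  classical
  obtain ⟨N, hN⟩ := exists_degree_bound (P.support ∪ Q.support ∪ R.support ∪ {0})
  have hN0 : N ≠ 0 := by
    have := hN 0 (by simp) 0
    simp at this
    omega
  have hP := abs_coeff_le_torusAvg hN0 (P := P) (fun v hv => hN v (by simp [mem_support_iff.1 hv])) u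
  have hQ := torusAvg_norm_sq hN0 (P := Q) (fun v hv => hN v (by simp [mem_support_iff.1 hv]))
  have hR := torusAvg_norm_sq hN0 (P := R) (fun v hv => hN v (by simp [mem_support_iff.1 hv]))
  refine hP.trans ((torusAvg_mono h).trans ?_)
  rw [torusAvg_linear hN0, hQ, hR]

/-- The elementary symmetric functions of `x, y, z` all have modulus one. -/
def UnitSym (x y z : ℂ) : Prop :=
  ‖x + y + z‖ = 1 ∧ ‖x * y + x * z + y * z‖ = 1 ∧ ‖x * y * z‖ = 1

lemma HasRoots.unitSym {f : Fin 4 → ℂ} {ρ : Fin 3 → ℂ} (h : HasRoots f ρ) (hf : ∀ i, ‖f i‖ = 1) :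
    UnitSym (ρ 0) (ρ 1) (ρ 2) := by
  obtain ⟨h2, h1, h0⟩ := h
  have e2 := congrArg norm h2
  have e1 := congrArg norm h1
  have e0 := congrArg norm h0
  rw [norm_neg, norm_mul, hf, hf, one_mul] at e2 e0
  rw [norm_mul, hf, hf, one_mul] at e1
  exact ⟨e2.symm, e1.symm, e0.symm⟩

lemma UnitSym.swap {x y z : ℂ} (h : UnitSym x y z) : UnitSym y x z := by
  obtain ⟨h1, h2, h3⟩ := h
  refine ⟨?_, ?_, ?_⟩
  · rw [← h1]; ring_nf
  · rw [← h2]; ring_nf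
  · rw [← h3]; ring_nf

lemma UnitSym.rotate {x y z : ℂ} (h : UnitSym x y z) : UnitSym z x y := by
  obtain ⟨h1, h2, h3⟩ := h
  refine ⟨?_, ?_, ?_⟩
  · rw [← h1]; ring_nf
  · rw [← h2]; ring_nf
  · rw [← h3]; ring_nf

lemma UnitSym.mul {x y z : ℂ} (h : UnitSym x y z) : UnitSym (x * y) (x * z) (y * z) := by
  obtain ⟨h1, h2, h3⟩ := h
  refine ⟨h2, ?_, ?_⟩
  · rw [show x * y * (x * z) + x * y * (y * z) + x * z * (y * z) = (x + y + z) * (x * y * z) by ring,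
      norm_mul, h1, h3, one_mul]
  · rw [show x * y * (x * z) * (y * z) = (x * y * z) * (x * y * z) by ring, norm_mul, h3, one_mul]

lemma UnitSym.norm_le {x y z : ℂ} (h : UnitSym x y z) {α : ℝ} (hα : α ^ 3 - α ^ 2 - α - 1 = 0) :
    ‖x‖ ≤ α := by
  obtain ⟨h1, h2, h3⟩ := h
  have hl := lt_root hα
  by_contra! hx
  have h4 : ‖x ^ 3‖ ≤ ‖x‖ ^ 2 + ‖x‖ + 1 := by
    rw [show x ^ 3 = (x + y + z) * x ^ 2 - (x * y + x * z + y * z) * x + x * y * z by ring]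
    refine (norm_add_le _ _).trans (add_le_add ((norm_sub_le _ _).trans (add_le_add ?_ ?_)) h3.le)
    · rw [norm_mul, h1, norm_pow, one_mul]
    · rw [norm_mul, h2, one_mul]
  rw [norm_pow] at h4
  have h5 : 0 < (‖x‖ - α) * (‖x‖ ^ 2 + ‖x‖ * α + α ^ 2 - ‖x‖ - α - 1) :=
    mul_pos (by linarith) (by nlinarith)
  nlinarith

lemma eq_norm_of_add_eq {a b c : ℂ} (h : a + b + c = ((‖a‖ + ‖b‖ + ‖c‖ : ℝ) : ℂ)) :
    a = (‖a‖ : ℂ) ∧ b = (‖b‖ : ℂ) ∧ c = (‖c‖ : ℂ) := by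
  have h1 := congrArg Complex.re h
  simp only [Complex.add_re, Complex.ofReal_re] at h1
  have ha := Complex.re_le_norm a
  have hb := Complex.re_le_norm b
  have hc := Complex.re_le_norm c
  have key : ∀ w : ℂ, w.re = ‖w‖ → w = (‖w‖ : ℂ) := fun w hw => by
    have := Complex.nonneg_iff.1 (Complex.re_eq_norm.1 hw)
    apply Complex.ext
    · simpa using hw
    · simpa using this.2.symm
  exact ⟨key a (by linarith), key b (by linarith), key c (by linarith)⟩

lemma norm_sq_of_add_mul {x y : ℂ} {s t : ℝ} (h1 : x + y = s) (h2 : x * y = t) (hst : s ^ 2 < 4 * t) :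
    ‖x‖ ^ 2 = t := by
  have h3 : x ^ 2 - s * x + t = 0 := by rw [← h1, ← h2]; ring
  have hr := congrArg Complex.re h3
  have hi := congrArg Complex.im h3
  simp [pow_two] at hr hi
  rw [← Complex.normSq_eq_norm_sq, Complex.normSq_apply]
  have h4 : x.im * (2 * x.re - s) = 0 := by linear_combination hi
  rcases mul_eq_zero.1 h4 with h | h
  · exfalso
    rw [h] at hr
    nlinarith [sq_nonneg (2 * x.re - s)]
  · linear_combination -hr + x.re * h

lemma abs_power_sums_lt {v w : ℝ} (hv : 0.7039 < v) (hv' : v < 0.7056) (hw : 0.543 < w)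
    (hw' : w < 0.544) : |v - 2 * w| < 0.48 ∧ |(v - 2 * w) ^ 2 - 2 * w ^ 2| < 0.48 := by
  have c1 : (v - 2 * w) ^ 2 < 0.1482 := by
    have : 0 < (v - 2 * w + 0.3849) * (0.3849 - (v - 2 * w)) :=
      mul_pos (by linarith) (by linarith)
    linarith
  have c2 : 0.29 < w ^ 2 := by nlinarith
  have c3 : w ^ 2 < 0.3 := by nlinarith
  have c4 : 0.12 < (v - 2 * w) ^ 2 := by
    have : 0 < (-0.38 - (v - 2 * w)) * (0.38 - (v - 2 * w)) :=
      mul_pos (by linarith) (by linarith)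
    linarith
  constructor <;> rw [abs_lt] <;> constructor <;> linarith

lemma UnitSym.of_norm_eq {x y z : ℂ} (h : UnitSym x y z) {α : ℝ} (hα : α ^ 3 - α ^ 2 - α - 1 = 0)
    (hx : ‖x‖ = α) : ‖y‖ < 3 / 4 ∧ ‖z‖ < 3 / 4 ∧ ‖y ^ 2 + z ^ 2‖ < 0.48 ∧ ‖y ^ 4 + z ^ 4‖ < 0.48 := by
  obtain ⟨h1, h2, h3⟩ := h
  have hl := lt_root hα
  have hu := root_lt hα
  have hα0 : α ≠ 0 := by linarith
  have hαc : (α : ℂ) ≠ 0 := by exact_mod_cast hα0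
  have hx0 : x ≠ 0 := by rw [← norm_ne_zero_iff, hx]; exact hα0
  have hsum := inv_root_sum hα
  have n1 : ‖(x + y + z) / x‖ = 1 / α := by rw [norm_div, h1, hx]
  have n2 : ‖-(x * y + x * z + y * z) / x ^ 2‖ = 1 / α ^ 2 := by
    rw [norm_div, norm_neg, h2, norm_pow, hx]
  have n3 : ‖x * y * z / x ^ 3‖ = 1 / α ^ 3 := by rw [norm_div, h3, norm_pow, hx]
  obtain ⟨e1, -, e3⟩ := eq_norm_of_add_eq (a := (x + y + z) / x)
    (b := -(x * y + x * z + y * z) / x ^ 2) (c := x * y * z / x ^ 3) (by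
      rw [n1, n2, n3, hsum]
      field_simp
      push_cast
      ring)
  rw [n1] at e1
  rw [n3] at e3
  have hinv : α * α⁻¹ = 1 := mul_inv_cancel₀ hα0
  have s1 : α * y / x + α * z / x = ((1 - α : ℝ) : ℂ) := by
    push_cast at e1 ⊢
    field_simp at e1 ⊢
    linear_combination e1
  have s2 : α * y / x * (α * z / x) = ((α⁻¹ : ℝ) : ℂ) := by
    push_cast at e3 ⊢
    field_simp at e3 ⊢
    linear_combination e3
  have hi1 : α⁻¹ < 0.544 := by nlinarith
  have hi2 : 0.543 < α⁻¹ := by nlinarith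
  have hdisc : (1 - α) ^ 2 < 4 * α⁻¹ := by nlinarith
  have hy := norm_sq_of_add_mul s1 s2 hdisc
  have hz := norm_sq_of_add_mul (by rw [add_comm]; exact s1) (by rw [mul_comm]; exact s2) hdisc
  have hny : ‖α * y / x‖ = ‖y‖ := by
    rw [norm_div, norm_mul, hx, Complex.norm_real, Real.norm_of_nonneg (by linarith)]; field_simp
  have hnz : ‖α * z / x‖ = ‖z‖ := by
    rw [norm_div, norm_mul, hx, Complex.norm_real, Real.norm_of_nonneg (by linarith)]; field_simp
  rw [hny] at hy
  rw [hnz] at hz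
  have hnu : ‖(x / α : ℂ)‖ = 1 := by
    rw [norm_div, hx, Complex.norm_real, Real.norm_of_nonneg (by linarith), div_self hα0]
  have p2 : y ^ 2 + z ^ 2 = (x / α) ^ 2 * (((1 - α) ^ 2 - 2 * α⁻¹ : ℝ) : ℂ) := by
    have : y ^ 2 + z ^ 2 = (x / α) ^ 2 * ((α * y / x + α * z / x) ^ 2 - 2 * (α * y / x * (α * z / x))) := by
      field_simp; ring
    rw [this, s1, s2]; push_cast; ring
  have p4 : y ^ 4 + z ^ 4 = (x / α) ^ 4 * ((((1 - α) ^ 2 - 2 * α⁻¹) ^ 2 - 2 * α⁻¹ ^ 2 : ℝ) : ℂ) := by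
    have : y ^ 4 + z ^ 4 = (x / α) ^ 4 * (((α * y / x + α * z / x) ^ 2 - 2 * (α * y / x * (α * z / x))) ^ 2
        - 2 * (α * y / x * (α * z / x)) ^ 2) := by
      field_simp; ring
    rw [this, s1, s2]; push_cast; ring
  have b1 : (1 - α) ^ 2 < 0.7056 := by nlinarith
  have b2 : 0.7039 < (1 - α) ^ 2 := by nlinarith
  refine ⟨?_, ?_, ?_, ?_⟩
  · refine lt_of_pow_lt_pow_left₀ 2 (by norm_num) ?_
    rw [hy]; linarith
  · refine lt_of_pow_lt_pow_left₀ 2 (by norm_num) ?_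
    rw [hz]; linarith
  · rw [p2, norm_mul, norm_pow, hnu, one_pow, one_mul, Complex.norm_real]
    exact (abs_power_sums_lt b2 b1 hi2 hi1).1
  · rw [p4, norm_mul, norm_pow, hnu, one_pow, one_mul, Complex.norm_real]
    exact (abs_power_sums_lt b2 b1 hi2 hi1).2

lemma UnitSym.exists_gap {α : ℝ} (hα : α ^ 3 - α ^ 2 - α - 1 = 0) :
    ∃ r : ℝ, 1 ≤ r ∧ r < α ∧ ∀ x y z : ℂ, UnitSym x y z → r < ‖x‖ →
      ‖y‖ ≤ 3 / 4 ∧ ‖z‖ ≤ 3 / 4 ∧ ‖y ^ 2 + z ^ 2‖ ≤ 0.48 ∧ ‖y ^ 4 + z ^ 4‖ ≤ 0.48 := by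
  have hl := lt_root hα
  let S : Set (ℂ × ℂ × ℂ) := {v | UnitSym v.1 v.2.1 v.2.2 ∧
    (3 / 4 ≤ ‖v.2.1‖ ∨ 3 / 4 ≤ ‖v.2.2‖ ∨ 0.48 ≤ ‖v.2.1 ^ 2 + v.2.2 ^ 2‖ ∨
      0.48 ≤ ‖v.2.1 ^ 4 + v.2.2 ^ 4‖)}
  have hS : IsCompact S := by
    apply Metric.isCompact_of_isClosed_isBounded
    · simp only [S, UnitSym, Set.ofPred_and, Set.ofPred_or]
      refine IsClosed.inter (IsClosed.inter ?_ (IsClosed.inter ?_ ?_))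
        (IsClosed.union ?_ (IsClosed.union ?_ (IsClosed.union ?_ ?_)))
      · exact isClosed_eq (by fun_prop) (by fun_prop)
      · exact isClosed_eq (by fun_prop) (by fun_prop)
      · exact isClosed_eq (by fun_prop) (by fun_prop)
      · exact isClosed_le (by fun_prop) (by fun_prop)
      · exact isClosed_le (by fun_prop) (by fun_prop)
      · exact isClosed_le (by fun_prop) (by fun_prop)
      · exact isClosed_le (by fun_prop) (by fun_prop)
    · refine (Metric.isBounded_closedBall (x := (0 : ℂ × ℂ × ℂ)) (r := α)).subset ?_
      rintro ⟨x, y, z⟩ ⟨h, -⟩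
      rw [mem_closedBall_zero_iff]
      simp only [Prod.norm_def]
      exact max_le (h.norm_le hα) (max_le (h.swap.norm_le hα) (h.rotate.norm_le hα))
  by_cases hne : S.Nonempty
  · obtain ⟨⟨x, y, z⟩, hv, hmax⟩ := hS.exists_isMaxOn hne (f := fun v => ‖v.1‖) (by fun_prop)
    have hlt : ‖x‖ < α := by
      refine lt_of_le_of_ne (hv.1.norm_le hα) fun heq => ?_
      obtain ⟨b1, b2, b3, b4⟩ := hv.1.of_norm_eq hα heq
      rcases hv.2 with h | h | h | h
      · exact absurd b1 (not_lt.2 h)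
      · exact absurd b2 (not_lt.2 h)
      · exact absurd b3 (not_lt.2 h)
      · exact absurd b4 (not_lt.2 h)
    refine ⟨max ‖x‖ 1, le_max_right _ _, max_lt hlt (by linarith), fun x' y' z' h hx' => ?_⟩
    by_contra hcon
    have hmem : (x', y', z') ∈ S := by
      refine ⟨h, ?_⟩
      by_contra! hc
      exact hcon ⟨hc.1.le, hc.2.1.le, hc.2.2.1.le, hc.2.2.2.le⟩
    exact absurd (hmax hmem) (not_le.2 ((le_max_left _ _).trans_lt hx'))
  · refine ⟨1, le_rfl, by linarith, fun x' y' z' h _ => ?_⟩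
    by_contra hcon
    refine hne ⟨(x', y', z'), h, ?_⟩
    by_contra! hc
    exact hcon ⟨hc.1.le, hc.2.1.le, hc.2.2.1.le, hc.2.2.2.le⟩

/-- The monomial symmetric function of `x, y, z` with exponents `0, q, p`. -/
def monoSym (q p : ℕ) (x y z : ℂ) : ℂ :=
  y ^ q * z ^ p + y ^ p * z ^ q + x ^ q * z ^ p + x ^ p * z ^ q + x ^ q * y ^ p + x ^ p * y ^ q

lemma norm_monoSym_le {q p : ℕ} (hqp : q ≤ p) {x y z : ℂ} {r α : ℝ} (hx : ‖x‖ ≤ r) (hy : ‖y‖ ≤ r)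
    (hz : ‖z‖ ≤ r) (hxy : ‖x * y‖ ≤ α) (hxz : ‖x * z‖ ≤ α) (hyz : ‖y * z‖ ≤ α) :
    ‖monoSym q p x y z‖ ≤ 6 * (α ^ q * r ^ (p - q)) := by
  obtain ⟨s, rfl⟩ := Nat.exists_eq_add_of_le hqp
  rw [Nat.add_sub_cancel_left]
  have key : ∀ a b : ℂ, ‖a * b‖ ≤ α → ‖b‖ ≤ r → ‖a ^ q * b ^ (q + s)‖ ≤ α ^ q * r ^ s := by
    intro a b hab hb
    rw [show a ^ q * b ^ (q + s) = (a * b) ^ q * b ^ s by ring, norm_mul, norm_pow, norm_pow]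
    gcongr
    exact pow_nonneg ((norm_nonneg _).trans hab) _
  have key' : ∀ a b : ℂ, ‖a * b‖ ≤ α → ‖a‖ ≤ r → ‖a ^ (q + s) * b ^ q‖ ≤ α ^ q * r ^ s := by
    intro a b hab hb
    rw [mul_comm]
    exact key b a (by rwa [mul_comm]) hb
  rw [monoSym]
  refine (norm_add_le_of_le (norm_add_le_of_le (norm_add_le_of_le (norm_add_le_of_le
    (norm_add_le_of_le (key _ _ hyz hz) (key' _ _ hyz hy)) (key _ _ hxz hz)) (key' _ _ hxz hx))
    (key _ _ hxy hy)) (key' _ _ hxy hx)).trans (le_of_eq ?_)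
  ring

lemma norm_add_pow_le {y z : ℂ} (hy : ‖y‖ ≤ 3 / 4) (hz : ‖z‖ ≤ 3 / 4) (h2 : ‖y ^ 2 + z ^ 2‖ ≤ 0.48)
    (h4 : ‖y ^ 4 + z ^ 4‖ ≤ 0.48) {q : ℕ} (hq : q = 2 ∨ 4 ≤ q) : ‖y ^ q + z ^ q‖ ≤ 0.48 := by
  rcases hq with rfl | hq
  · exact h2
  rcases hq.eq_or_lt with rfl | hq
  · exact h4
  have key : ∀ w : ℂ, ‖w‖ ≤ 3 / 4 → ‖w ^ q‖ ≤ (3 / 4 : ℝ) ^ 5 := fun w hw => by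
    rw [norm_pow]
    exact (pow_le_pow_left₀ (norm_nonneg _) hw q).trans
      (pow_le_pow_of_le_one (by norm_num) (by norm_num) hq)
  refine (norm_add_le_of_le (key y hy) (key z hz)).trans (by norm_num)

lemma norm_monoSym_le_of_gap {q p k l : ℕ} (hq : q = 2 ∨ 4 ≤ q) (hkl : k + l = p)
    {x y z : ℂ} {α : ℝ} (hα : 1 ≤ α) (hx : ‖x‖ ≤ α) (hy : ‖y‖ ≤ 3 / 4) (hz : ‖z‖ ≤ 3 / 4)
    (h2 : ‖y ^ 2 + z ^ 2‖ ≤ 0.48) (h4 : ‖y ^ 4 + z ^ 4‖ ≤ 0.48) :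
    ‖monoSym q p x y z‖ ≤ 0.48 * (‖x ^ k + y ^ k + z ^ k‖ + 2) * (‖x ^ l + y ^ l + z ^ l‖ + 2) +
      6 * α ^ q := by
  have h1 := norm_add_pow_le hy hz h2 h4 hq
  have hle : ∀ w : ℂ, ‖w‖ ≤ 3 / 4 → ∀ m, ‖w ^ m‖ ≤ 1 := fun w hw m => by
    rw [norm_pow]
    exact pow_le_one₀ (norm_nonneg _) (by linarith)
  have hk : ∀ m, ‖x‖ ^ m ≤ ‖x ^ m + y ^ m + z ^ m‖ + 2 := fun m => by
    have := norm_sub_le_of_le (norm_sub_le_of_le (le_refl ‖x ^ m + y ^ m + z ^ m‖) (hle y hy m)) (hle z hz m)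
    rw [show x ^ m + y ^ m + z ^ m - y ^ m - z ^ m = x ^ m by ring, norm_pow] at this
    linarith
  have hαq : 1 ≤ α ^ q := one_le_pow₀ hα
  have hmul : ∀ a b : ℂ, ‖a‖ ≤ α ^ q → ‖b‖ ≤ 1 → ‖a * b‖ ≤ α ^ q := fun a b ha hb => by
    rw [norm_mul]
    exact (mul_le_mul ha hb (norm_nonneg _) (by positivity)).trans_eq (mul_one _)
  have hxq : ‖x ^ q‖ ≤ α ^ q := by
    rw [norm_pow]; exact pow_le_pow_left₀ (norm_nonneg _) hx q
  rw [show monoSym q p x y z = x ^ p * (y ^ q + z ^ q) + (y ^ q * z ^ p + y ^ p * z ^ q +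
    x ^ q * z ^ p + x ^ q * y ^ p) by rw [monoSym]; ring]
  have b1 : ‖x ^ p * (y ^ q + z ^ q)‖ ≤
      0.48 * (‖x ^ k + y ^ k + z ^ k‖ + 2) * (‖x ^ l + y ^ l + z ^ l‖ + 2) := by
    rw [norm_mul, norm_pow, ← hkl, pow_add]
    calc _ ≤ (‖x ^ k + y ^ k + z ^ k‖ + 2) * (‖x ^ l + y ^ l + z ^ l‖ + 2) * 0.48 := by
          gcongr
          · exact hk k
          · exact hk l
      _ = _ := by ring
  have b2 := norm_add_le_of_le (norm_add_le_of_le (norm_add_le_of_le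
    (hmul _ _ ((hle y hy q).trans hαq) (hle z hz p)) (hmul _ _ ((hle y hy p).trans hαq) (hle z hz q)))
    (hmul _ _ hxq (hle z hz p))) (hmul _ _ hxq (hle y hy p))
  refine (norm_add_le_of_le b1 b2).trans ?_
  linarith

lemma pow_mul_pow_le_sqrt {r α : ℝ} (hr : 1 ≤ r) (hrα : r ≤ α) {q p : ℕ} (hqp : 2 * q ≤ p) :
    α ^ q * r ^ (p - q) ≤ Real.sqrt (r * α) ^ p := by
  obtain ⟨s, rfl⟩ := Nat.exists_eq_add_of_le hqp
  apply le_of_sq_le_sq _ (by positivity)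
  rw [← pow_mul, mul_comm _ 2, pow_mul, Real.sq_sqrt (by nlinarith),
    show 2 * q + s - q = q + s by omega]
  calc (α ^ q * r ^ (q + s)) ^ 2 = (r * α) ^ (2 * q) * (r * r) ^ s := by ring
    _ ≤ (r * α) ^ (2 * q) * (r * α) ^ s := by
        have : 0 ≤ r * α := by nlinarith
        gcongr
    _ = _ := by ring

lemma exists_norm_monoSym_le {α : ℝ} (hα : α ^ 3 - α ^ 2 - α - 1 = 0) :
    ∃ B : ℝ, 1 ≤ B ∧ B < α ∧ ∀ x y z : ℂ, UnitSym x y z → ∀ q p k l : ℕ, (q = 2 ∨ 4 ≤ q) →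
      2 * q ≤ p → k + l = p → ‖monoSym q p x y z‖ ≤
        0.48 * (‖x ^ k + y ^ k + z ^ k‖ + 2) * (‖x ^ l + y ^ l + z ^ l‖ + 2) + 6 * B ^ p := by
  obtain ⟨r, hr1, hrα, hr⟩ := UnitSym.exists_gap hα
  refine ⟨Real.sqrt (r * α), ?_, ?_, ?_⟩
  · rw [Real.one_le_sqrt]; nlinarith
  · rw [Real.sqrt_lt' (by linarith)]; nlinarith
  have hpt : ∀ x y z : ℂ, UnitSym x y z → r < ‖x‖ → ∀ q p k l : ℕ, (q = 2 ∨ 4 ≤ q) →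
      2 * q ≤ p → k + l = p → ‖monoSym q p x y z‖ ≤
        0.48 * (‖x ^ k + y ^ k + z ^ k‖ + 2) * (‖x ^ l + y ^ l + z ^ l‖ + 2) +
          6 * Real.sqrt (r * α) ^ p := by
    intro x y z h hx q p k l hq hqp hkl
    obtain ⟨hy, hz, h2, h4⟩ := hr x y z h hx
    refine (norm_monoSym_le_of_gap hq hkl (by linarith) (h.norm_le hα) hy hz h2 h4).trans ?_
    have h5 := pow_mul_pow_le_sqrt hr1 hrα.le hqp
    have h6 : α ^ q ≤ α ^ q * r ^ (p - q) :=
      le_mul_of_one_le_right (pow_nonneg (by linarith) _) (one_le_pow₀ hr1)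
    linarith
  intro x y z h q p k l hq hqp hkl
  by_cases hx : r < ‖x‖
  · exact hpt x y z h hx q p k l hq hqp hkl
  by_cases hy : r < ‖y‖
  · have := hpt y x z h.swap hy q p k l hq hqp hkl
    rwa [show monoSym q p y x z = monoSym q p x y z by rw [monoSym, monoSym]; ring,
      add_comm (y ^ k), add_comm (y ^ l)] at this
  by_cases hz : r < ‖z‖
  · have := hpt z x y h.rotate hz q p k l hq hqp hkl
    rwa [show monoSym q p z x y = monoSym q p x y z by rw [monoSym, monoSym]; ring,
      add_assoc (z ^ k), add_comm (z ^ k), add_assoc (z ^ l), add_comm (z ^ l)] at this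
  push Not at hx hy hz
  refine (norm_monoSym_le (by omega) hx hy hz (h.mul.norm_le hα) (h.mul.swap.norm_le hα)
    (h.mul.rotate.norm_le hα)).trans ?_
  have h5 := pow_mul_pow_le_sqrt hr1 hrα.le hqp
  have h6 : 0 ≤ 0.48 * (‖x ^ k + y ^ k + z ^ k‖ + 2) * (‖x ^ l + y ^ l + z ^ l‖ + 2) := by positivity
  linarith

lemma UnitSym.norm_power_sum_le {x y z : ℂ} (h : UnitSym x y z) {α : ℝ}
    (hα : α ^ 3 - α ^ 2 - α - 1 = 0) (hx : x = α) (k : ℕ) : ‖x ^ k + y ^ k + z ^ k‖ ≤ α ^ k + 2 := by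
  have hl := lt_root hα
  have hn : ‖x‖ = α := by rw [hx, Complex.norm_real, Real.norm_of_nonneg (by linarith)]
  obtain ⟨hy, hz, -⟩ := h.of_norm_eq hα hn
  have hle : ∀ w : ℂ, ‖w‖ < 3 / 4 → ‖w ^ k‖ ≤ 1 := fun w hw => by
    rw [norm_pow]
    exact pow_le_one₀ (norm_nonneg _) (by linarith)
  have := norm_add_le_of_le (norm_add_le_of_le (le_refl ‖x ^ k‖) (hle y hy)) (hle z hz)
  rw [norm_pow, hn] at this
  linarith

lemma sum_signedCoeff_powSum_le {α : ℝ} (hα : α ^ 3 - α ^ 2 - α - 1 = 0) (k : ℕ) :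
    ∑ u ∈ (powSum k).support, signedCoeff (powSum k) u ≤ α ^ k + 2 := by
  let f : Fin 4 → ℂ := ![-1, -1, -1, 1]
  have hf : ∀ i, ‖f i‖ = 1 := by intro i; fin_cases i <;> simp [f]
  obtain ⟨ρ, h⟩ := exists_hasRoots f (by simp [f])
  have hU := h.unitSym hf
  have h1 : aeval f (powSum k) =
      ((∑ u ∈ (powSum k).support, signedCoeff (powSum k) u : ℝ) : ℂ) := by
    rw [aeval_def, eval₂_eq', Complex.ofReal_sum]
    refine Finset.sum_congr rfl fun u _ => ?_
    simp [signedCoeff, Fin.prod_univ_four, f, pow_add]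
    ring
  have h2 : ‖ρ 0 ^ k + ρ 1 ^ k + ρ 2 ^ k‖ ≤ α ^ k + 2 := by
    have hroot : ((α : ℂ) - ρ 0) * ((α - ρ 1) * (α - ρ 2)) = 0 := by
      obtain ⟨h2, h1, h0⟩ := h
      simp [f] at h2 h1 h0
      have hc : (α : ℂ) ^ 3 - α ^ 2 - α - 1 = 0 := by exact_mod_cast congrArg (fun t : ℝ => (t : ℂ)) hα
      linear_combination hc - (α : ℂ) ^ 2 * h2 - (α : ℂ) * h1 + h0
    rcases mul_eq_zero.1 hroot with h | h
    · exact hU.norm_power_sum_le hα (sub_eq_zero.1 h).symm k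
    rcases mul_eq_zero.1 h with h | h
    · have := hU.swap.norm_power_sum_le hα (sub_eq_zero.1 h).symm k
      rwa [add_comm (ρ 1 ^ k)] at this
    · have := hU.rotate.norm_power_sum_le hα (sub_eq_zero.1 h).symm k
      rwa [add_assoc, add_comm] at this
  have h3 := aeval_powSum k h
  rw [h1] at h3
  have h4 := congrArg norm h3
  rw [norm_mul, norm_pow, hf, one_pow, one_mul, Complex.norm_real] at h4
  exact (Real.le_norm_self _).trans (h4.trans_le h2)

lemma signedCoeff_powSum_nonneg (k : ℕ) (u : Fin 4 →₀ ℕ) : 0 ≤ signedCoeff (powSum k) u := by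
  rw [signedCoeff_powSum]
  split_ifs
  · exact wt_nonneg _ _ _
  · exact le_rfl

lemma signedBound_powSum_pow {α : ℝ} (hα : α ^ 3 - α ^ 2 - α - 1 = 0) (k : ℕ) :
    SignedBound (powSum k) (α ^ k + 2) := fun u => by
  refine ⟨signedCoeff_powSum_nonneg k u, ?_⟩
  refine le_trans ?_ (sum_signedCoeff_powSum_le hα k)
  by_cases hu : u ∈ (powSum k).support
  · exact Finset.single_le_sum (fun v _ => signedCoeff_powSum_nonneg k v) hu
  · rw [signedCoeff, notMem_support_iff.1 hu]
    simpa using Finset.sum_nonneg fun v _ => signedCoeff_powSum_nonneg k v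

lemma sum_sq_powSum_le {α : ℝ} (hα : α ^ 3 - α ^ 2 - α - 1 = 0) {k : ℕ} {W : ℝ}
    (h : SignedBound (powSum k) W) :
    ∑ u ∈ (powSum k).support, ((coeff u (powSum k) : ℤ) : ℝ) ^ 2 ≤ W * (α ^ k + 2) := by
  refine le_trans ?_ (mul_le_mul_of_nonneg_left (sum_signedCoeff_powSum_le hα k) h.nonneg)
  rw [Finset.mul_sum]
  refine Finset.sum_le_sum fun u _ => ?_
  rw [← sq_abs, ← abs_signedCoeff, sq_abs, pow_two]
  exact mul_le_mul_of_nonneg_right (h u).2 (h u).1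

lemma norm_aeval_gCoeff {n : ℕ} {i j k : Fin (n + 1)} (hij : i < j) (hjk : j < k) {f : Fin 4 → ℂ}
    (hf : ∀ i, ‖f i‖ = 1) {ρ : Fin 3 → ℂ} (h : HasRoots f ρ) :
    ‖aeval f (gCoeff n (Finsupp.single i 1 + Finsupp.single j 1 + Finsupp.single k 1))‖ =
      ‖monoSym (j - i) (k - i) (ρ 0) (ρ 1) (ρ 2)‖ := by
  have hU := h.unitSym hf
  rw [eval_gCoeff n _ f ρ h, norm_mul, norm_mul, norm_pow, norm_pow, norm_neg, norm_one, hf, one_pow,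
    one_pow, one_mul, one_mul, symSum_three hij hjk]
  rw [Fin.lt_def] at hij hjk
  obtain ⟨q, hq⟩ := Nat.exists_eq_add_of_le hij.le
  obtain ⟨p, hp⟩ := Nat.exists_eq_add_of_le (hij.trans hjk).le
  rw [hq, hp, Nat.add_sub_cancel_left, Nat.add_sub_cancel_left]
  generalize (i : ℕ) = i
  calc _ = ‖(ρ 0 * ρ 1 * ρ 2) ^ i * monoSym q p (ρ 0) (ρ 1) (ρ 2)‖ := by
        congr 1; rw [monoSym]; ring
    _ = _ := by rw [norm_mul, norm_pow, hU.2.2, one_pow, one_mul]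

lemma coeffBound_gCoeff_pow {α : ℝ} (hα : α ^ 3 - α ^ 2 - α - 1 = 0) {n : ℕ} {i j k : Fin (n + 1)}
    (hij : i < j) (hjk : j < k) :
    CoeffBound (gCoeff n (Finsupp.single i 1 + Finsupp.single j 1 + Finsupp.single k 1))
      (6 * α ^ (k - i : ℕ)) := fun u => by
  rw [abs_signedCoeff]
  have := abs_coeff_le_of_torus
    (P := gCoeff n (Finsupp.single i 1 + Finsupp.single j 1 + Finsupp.single k 1)) (Q := 0) (R := 0)
    (a := 0) (b := 0) (c := 6 * α ^ (k - i : ℕ)) (fun f hf => ?_) u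
  · simpa using this
  · obtain ⟨ρ, h⟩ := exists_hasRoots f (by rw [← norm_ne_zero_iff, hf]; exact one_ne_zero)
    have hU := h.unitSym hf
    rw [norm_aeval_gCoeff hij hjk hf h]
    rw [Fin.lt_def] at hij hjk
    refine (norm_monoSym_le (by omega) (hU.norm_le hα) (hU.swap.norm_le hα) (hU.rotate.norm_le hα)
      (hU.mul.norm_le hα) (hU.mul.swap.norm_le hα) (hU.mul.rotate.norm_le hα)).trans ?_
    rw [← pow_add, show (j - i : ℕ) + (k - i - (j - i)) = k - i by omega]
    simp

lemma exists_coeffBound_gCoeff_torus {α : ℝ} (hα : α ^ 3 - α ^ 2 - α - 1 = 0) :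
    ∃ B : ℝ, 1 ≤ B ∧ B < α ∧ ∀ (n : ℕ) (i j k : Fin (n + 1)) (p q s t : ℕ) (W W' μ : ℝ),
      i < j → j < k → q = j - i → p = k - i → (q = 2 ∨ 4 ≤ q) → 2 * q ≤ p → s + t = p →
      SignedBound (powSum s) W → SignedBound (powSum t) W' → 0 < μ →
      CoeffBound (gCoeff n (Finsupp.single i 1 + Finsupp.single j 1 + Finsupp.single k 1))
        (0.2424 * μ * (W * (α ^ s + 2)) + 0.2424 / μ * (W' * (α ^ t + 2)) +
          (96.96 * (μ + 1 / μ) + 6 * B ^ p)) := by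
  obtain ⟨B, hB1, hBα, hB⟩ := exists_norm_monoSym_le hα
  refine ⟨B, hB1, hBα, ?_⟩
  rintro n i j k p q s t W W' μ hij hjk hq hp hq' hqp hst hW hW' hμ u
  rw [abs_signedCoeff]
  refine (abs_coeff_le_of_torus (Q := powSum s) (R := powSum t)
    (a := 0.2424 * μ) (b := 0.2424 / μ) (c := 96.96 * (μ + 1 / μ) + 6 * B ^ p) (fun f hf => ?_) u).trans ?_
  · obtain ⟨ρ, h⟩ := exists_hasRoots f (by rw [← norm_ne_zero_iff, hf]; exact one_ne_zero)
    rw [norm_aeval_gCoeff hij hjk hf h, ← hq, ← hp]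
    refine (hB _ _ _ (h.unitSym hf) q p s t hq' hqp hst).trans ?_
    have hnorm : ∀ m, ‖aeval f (powSum m)‖ = ‖ρ 0 ^ m + ρ 1 ^ m + ρ 2 ^ m‖ := fun m => by
      rw [aeval_powSum m h, norm_mul, norm_pow, hf, one_pow, one_mul]
    rw [← hnorm, ← hnorm]
    generalize ‖aeval f (powSum s)‖ = x
    generalize ‖aeval f (powSum t)‖ = y
    have h1 : ∀ x : ℝ, (x + 2) ^ 2 ≤ 1.01 * x ^ 2 + 404 := fun x => by nlinarith [sq_nonneg (x - 200)]
    have h2 : (x + 2) * (y + 2) ≤ (μ * (x + 2) ^ 2 + (y + 2) ^ 2 / μ) / 2 := by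
      have h3 : 0 ≤ (μ * (x + 2) - (y + 2)) ^ 2 / μ := by positivity
      have h4 : (μ * (x + 2) - (y + 2)) ^ 2 / μ =
          μ * (x + 2) ^ 2 + (y + 2) ^ 2 / μ - 2 * ((x + 2) * (y + 2)) := by
        field_simp; ring
      linarith
    have h5 := mul_le_mul_of_nonneg_left (h1 x) hμ.le
    have h6 := div_le_div_of_nonneg_right (h1 y) hμ.le
    calc _ ≤ 0.48 * ((μ * (1.01 * x ^ 2 + 404) + (1.01 * y ^ 2 + 404) / μ) / 2) + 6 * B ^ p := by
          linarith
      _ = _ := by ring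
  · have h1 := sum_sq_powSum_le hα hW
    have h2 := sum_sq_powSum_le hα hW'
    gcongr

lemma mainTerm_pos {α : ℝ} (hα : α ^ 3 - α ^ 2 - α - 1 = 0) {n : ℕ} (hn : 1 ≤ n) :
    0 < mainTerm α n := by
  have h1 := lt_root hα
  have h2 := (meanIdx_bounds hα).1
  have h0 : 0 < α := by linarith
  have : 0 < meanIdx α := by linarith
  have : 0 < n := hn
  unfold mainTerm
  positivity

lemma mainTerm_mul {α : ℝ} {n m : ℕ} (hn : 1 ≤ n) (hm : 1 ≤ m) :
    mainTerm α n * α ^ m * ((n : ℝ) / (n + m)) = mainTerm α (n + m) := by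
  have : (n : ℝ) ≠ 0 := by positivity
  have : (n + m : ℝ) ≠ 0 := by positivity
  have := Real.pi_ne_zero
  unfold mainTerm
  push_cast
  field_simp
  ring

lemma mainTerm_le_succ {α : ℝ} (hα : α ^ 3 - α ^ 2 - α - 1 = 0) {n : ℕ} (hn : 100 ≤ n) :
    mainTerm α n ≤ 0.55 * mainTerm α (n + 1) := by
  have h1 := lt_root hα
  have hpos := mainTerm_pos hα (n := n) (by omega)
  rw [← mainTerm_mul (by omega) le_rfl, pow_one]
  have hn' : (100 : ℝ) ≤ n := by exact_mod_cast hn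
  have : 1 ≤ 0.55 * (α * ((n : ℝ) / (n + 1))) := by
    rw [← mul_div_assoc, ← mul_div_assoc, le_div_iff₀ (by positivity)]
    nlinarith
  push_cast
  nlinarith

lemma mainTerm_mono {α : ℝ} (hα : α ^ 3 - α ^ 2 - α - 1 = 0) {n m : ℕ} (hn : 100 ≤ n) (hm : n ≤ m) :
    mainTerm α n ≤ mainTerm α m := by
  induction m, hm using Nat.le_induction with
  | base => exact le_rfl
  | succ m hm ih =>
    have := mainTerm_le_succ hα (hn.trans hm)
    have := mainTerm_pos hα (n := m + 1) (by omega)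
    linarith

lemma mainTerm_le_pow {α : ℝ} (hα : α ^ 3 - α ^ 2 - α - 1 = 0) {n : ℕ} (hn : 1 ≤ n) :
    mainTerm α n ≤ 4 * α ^ n := by
  have h1 := lt_root hα
  have h2 := root_lt hα
  obtain ⟨h3, h4⟩ := meanIdx_bounds hα
  have hn' : (1 : ℝ) ≤ n := by exact_mod_cast hn
  have hα0 : 0 < α := by linarith
  have hpi := Real.pi_gt_three
  have h5 : α ^ 3 ≤ 6.3 := by nlinarith
  have h6 : meanIdx α ^ 2 ≤ 2.7 := by nlinarith
  have h7 : α ^ 3 * meanIdx α ^ 2 ≤ 6.3 * 2.7 := mul_le_mul h5 h6 (sq_nonneg _) (by norm_num)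
  unfold mainTerm
  rw [div_le_iff₀ (by positivity), pow_add]
  have h8 : 6 ≤ 2 * Real.pi * n := by nlinarith
  have h9 : 0 < α ^ n := by positivity
  calc α ^ n * α ^ 3 * meanIdx α ^ 2 = α ^ n * (α ^ 3 * meanIdx α ^ 2) := by ring
    _ ≤ α ^ n * (4 * 6) := mul_le_mul_of_nonneg_left (by linarith) h9.le
    _ ≤ α ^ n * (4 * (2 * Real.pi * n)) := by gcongr
    _ = _ := by ring

lemma pow_le_mainTerm {α : ℝ} (hα : α ^ 3 - α ^ 2 - α - 1 = 0) {n : ℕ} (hn : 1 ≤ n) :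
    α ^ n / n ≤ mainTerm α n := by
  have h1 := lt_root hα
  obtain ⟨h3, h4⟩ := meanIdx_bounds hα
  have hα0 : 0 < α := by linarith
  have hpi := Real.pi_lt_d2
  have hpi0 := Real.pi_pos
  have hn0 : (0 : ℝ) < n := by exact_mod_cast hn
  unfold mainTerm
  rw [div_le_div_iff₀ hn0 (by positivity), pow_add]
  have h5 : 6.2 ≤ α ^ 3 := by nlinarith
  have h6 : 2.59 ≤ meanIdx α ^ 2 := by nlinarith
  have h7 : 6.2 * 2.59 ≤ α ^ 3 * meanIdx α ^ 2 := mul_le_mul h5 h6 (by norm_num) (by positivity)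
  have h9 : 0 < α ^ n * n := by positivity
  nlinarith

/-- Exponentials with a smaller base are eventually negligible with respect to `mainTerm`. -/
lemma exists_pow_le_mainTerm {α : ℝ} (hα : α ^ 3 - α ^ 2 - α - 1 = 0) {D : ℝ} (hD0 : 0 ≤ D)
    (hD : D < α) (K : ℝ) : ∃ P : ℕ, ∀ p, P ≤ p → K * D ^ p ≤ 0.01 * mainTerm α p := by
  have hα0 : 0 < α := by linarith
  have h1 := tendsto_self_mul_const_pow_of_lt_one (r := D / α) (by positivity) (by rwa [div_lt_one hα0])
  have h1' := h1.const_mul K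
  rw [mul_zero] at h1'
  have h2 := h1'.eventually (ge_mem_nhds (show (0 : ℝ) < 0.01 by norm_num))
  obtain ⟨P, hP⟩ := Filter.eventually_atTop.1 h2
  refine ⟨max P 1, fun p hp => ?_⟩
  have hp1 : 1 ≤ p := (le_max_right _ _).trans hp
  have hp0 : (0 : ℝ) < p := by exact_mod_cast hp1
  have h3 := hP p ((le_max_left _ _).trans hp)
  refine le_trans ?_ (mul_le_mul_of_nonneg_left (pow_le_mainTerm hα hp1) (by norm_num))
  rw [mul_div_assoc', le_div_iff₀ hp0]
  rw [div_pow] at h3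
  have : 0 < α ^ p := by positivity
  calc K * D ^ p * p = K * (p * (D ^ p / α ^ p)) * α ^ p := by field_simp
    _ ≤ _ := by gcongr

lemma signedBound_powSum_mainTerm {α : ℝ} (hα : α ^ 3 - α ^ 2 - α - 1 = 0) {k : ℕ} (hk : 30000 ≤ k) :
    SignedBound (powSum k) (mainTerm α k * (1 - 1 / 10 / k)) := by
  refine signedBound_powSum ?_ fun a b c h => wt_le hα h hk
  have hk' : (30000 : ℝ) ≤ k := by exact_mod_cast hk
  refine mul_nonneg (mainTerm_pos hα (by omega)).le ?_
  rw [sub_nonneg, div_le_one (by positivity)]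
  linarith

lemma SignedBound.mono {P : MvPolynomial (Fin 4) ℤ} {B C : ℝ} (h : SignedBound P B) (hBC : B ≤ C) :
    SignedBound P C := fun u => ⟨(h u).1, (h u).2.trans hBC⟩

lemma signedBound_powSum_mainTerm' {α : ℝ} (hα : α ^ 3 - α ^ 2 - α - 1 = 0) {k : ℕ} (hk : 30000 ≤ k) :
    SignedBound (powSum k) (mainTerm α k) := by
  refine (signedBound_powSum_mainTerm hα hk).mono ?_
  have := mainTerm_pos hα (n := k) (by omega)
  refine mul_le_of_le_one_right this.le ?_
  have : (0 : ℝ) ≤ 1 / 10 / k := by positivity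
  linarith

/-- The bound on the torus, evaluated for an almost balanced splitting `s + t` of the exponent. -/
lemma torus_bound_le {α : ℝ} (hα : α ^ 3 - α ^ 2 - α - 1 = 0) {B D : ℝ} (hB : 1 ≤ B) (hBD : B ≤ D)
    (hD : α ≤ D ^ 2) {s t : ℕ} {μ : ℝ} (hs : 30000 ≤ s) (ht : t = s ∧ μ = 1 ∨ t = s + 1 ∧ μ = α) :
    0.2424 * μ * (mainTerm α s * (α ^ s + 2)) + 0.2424 / μ * (mainTerm α t * (α ^ t + 2)) +
      (96.96 * (μ + 1 / μ) + 6 * B ^ (s + t)) ≤ 0.97 * mainTerm α (s + t) + 400 * D ^ (s + t) := by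
  have h1 := lt_root hα
  have h2 := root_lt hα
  have hα0 : 0 < α := by linarith
  have hs' : (30000 : ℝ) ≤ s := by exact_mod_cast hs
  have hμ1 : 1 ≤ μ := by rcases ht with ⟨-, h⟩ | ⟨-, h⟩ <;> linarith
  have hμ2 : μ ≤ 2 := by rcases ht with ⟨-, h⟩ | ⟨-, h⟩ <;> linarith
  have hst : s ≤ t := by omega
  have htt : (t : ℝ) ≤ s + 1 := by
    have : t ≤ s + 1 := by omega
    exact_mod_cast this
  have htt' : (s : ℝ) ≤ t := by exact_mod_cast hst
  have hμt : α ^ t = μ * α ^ s := by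
    rcases ht with ⟨h, h'⟩ | ⟨h, h'⟩ <;> rw [h, h']
    · ring
    · ring
  have hM := mainTerm_pos hα (n := s + t) (by omega)
  have hms := mainTerm_mul (α := α) (n := s) (m := t) (by omega) (by omega)
  have hmt := mainTerm_mul (α := α) (n := t) (m := s) (by omega) (by omega)
  rw [add_comm t s] at hmt
  set M := mainTerm α (s + t) with hMdef
  have hμ0 : 0 < μ := by linarith
  have e1 : μ * (mainTerm α s * α ^ s) = M * ((s + t) / s) := by
    rw [← hms, hμt]; field_simp
  have e2 : 1 / μ * (mainTerm α t * α ^ t) = M * ((s + t) / t) := by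
    have ht0 : (t : ℝ) ≠ 0 := by linarith
    rw [← hmt, hμt, add_comm (t : ℝ)]; field_simp
  have b1 : ((s + t : ℝ) / s) ≤ 2.0001 := by
    rw [div_le_iff₀ (by linarith)]; linarith
  have b2 : ((s + t : ℝ) / t) ≤ 2.0001 := by
    rw [div_le_iff₀ (by linarith)]; linarith
  have m1 := mainTerm_le_pow hα (n := s) (by omega)
  have m2 := mainTerm_le_pow hα (n := t) (by omega)
  have hD1 : 1 ≤ D := hB.trans hBD
  have hDs : α ^ s ≤ D ^ (s + t) := by
    calc α ^ s ≤ (D ^ 2) ^ s := by gcongr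
      _ = D ^ (2 * s) := by rw [pow_mul]
      _ ≤ D ^ (s + t) := pow_le_pow_right₀ hD1 (by omega)
  have hDB : B ^ (s + t) ≤ D ^ (s + t) := by gcongr
  have hDone : 1 ≤ D ^ (s + t) := one_le_pow₀ hD1
  have c1 : μ * mainTerm α s ≤ 8 * α ^ s := by
    calc μ * mainTerm α s ≤ 2 * (4 * α ^ s) := by
          gcongr
          exact (mainTerm_pos hα (by omega)).le
      _ = _ := by ring
  have c2 : 1 / μ * mainTerm α t ≤ 4 * α ^ s := by
    calc 1 / μ * mainTerm α t ≤ 1 / μ * (4 * α ^ t) := by gcongr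
      _ = _ := by rw [hμt]; field_simp
  have c3 : 1 / μ ≤ 1 := by rw [div_le_one hμ0]; exact hμ1
  have d1 := mul_le_mul_of_nonneg_left b1 hM.le
  have d2 := mul_le_mul_of_nonneg_left b2 hM.le
  calc _ = 0.2424 * (μ * (mainTerm α s * α ^ s)) + 0.2424 * (1 / μ * (mainTerm α t * α ^ t)) +
        0.4848 * (μ * mainTerm α s) + 0.4848 * (1 / μ * mainTerm α t) +
        (96.96 * (μ + 1 / μ) + 6 * B ^ (s + t)) := by ring
    _ ≤ _ := by rw [e1, e2]; linarith

lemma exists_coeffBound_gCoeff_half {α : ℝ} (hα : α ^ 3 - α ^ 2 - α - 1 = 0) :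
    ∃ P : ℕ, ∀ (n : ℕ) (i j k : Fin (n + 1)), i < j → j < k → 2 * (j - i : ℕ) ≤ k - i → P ≤ (k - i : ℕ) →
      CoeffBound (gCoeff n (Finsupp.single i 1 + Finsupp.single j 1 + Finsupp.single k 1))
        (0.99 * mainTerm α (k - i)) := by
  have hl := lt_root hα
  obtain ⟨B, hB1, hBα, hB⟩ := exists_coeffBound_gCoeff_torus hα
  have hD : max B (Real.sqrt α) < α := by
    refine max_lt hBα ?_
    rw [Real.sqrt_lt' (by linarith)]
    nlinarith
  have hD0 : 0 ≤ max B (Real.sqrt α) := le_max_of_le_right (Real.sqrt_nonneg _)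
  obtain ⟨P, hP⟩ := exists_pow_le_mainTerm hα hD0 hD 400
  refine ⟨max P 70000, fun n i j k hij hjk hqp hp => ?_⟩
  have hp' : 70000 ≤ (k - i : ℕ) := (le_max_right _ _).trans hp
  have hPk := hP _ ((le_max_left _ _).trans hp)
  have hij' := Fin.lt_def.1 hij
  have hjk' := Fin.lt_def.1 hjk
  by_cases h1 : (j : ℕ) = i + 1
  · obtain ⟨s, hs⟩ : ∃ s, (k : ℕ) = i + s + 2 := ⟨k - i - 2, by omega⟩
    refine (coeffBound_gCoeff_succ h1 s hs (signedBound_powSum_mainTerm' hα (by omega))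
      (signedBound_powSum_mainTerm' hα (by omega))).mono ?_
    rw [show (k - i : ℕ) = s + 2 by omega]
    have := mainTerm_le_succ hα (n := s) (by omega)
    have := mainTerm_le_succ hα (n := s + 1) (by omega)
    have := mainTerm_pos hα (n := s + 2) (by omega)
    linarith
  by_cases h3 : (j : ℕ) = i + 3
  · obtain ⟨s, hs⟩ : ∃ s, (k : ℕ) = i + s + 5 := ⟨k - i - 5, by omega⟩
    refine (coeffBound_gCoeff_add_three h3 s hs (signedBound_powSum_mainTerm' hα (by omega))
      (signedBound_powSum_mainTerm' hα (by omega)) (signedBound_powSum_mainTerm' hα (by omega))).mono ?_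
    rw [show (k - i : ℕ) = s + 5 by omega]
    have := mainTerm_le_succ hα (n := s) (by omega)
    have := mainTerm_le_succ hα (n := s + 1) (by omega)
    have := mainTerm_le_succ hα (n := s + 2) (by omega)
    have := mainTerm_le_succ hα (n := s + 3) (by omega)
    have := mainTerm_le_succ hα (n := s + 4) (by omega)
    have := mainTerm_pos hα (n := s + 5) (by omega)
    linarith
  have hDα : α ≤ max B (Real.sqrt α) ^ 2 := by
    calc α = Real.sqrt α ^ 2 := (Real.sq_sqrt (by linarith)).symm
      _ ≤ _ := by gcongr; exact le_max_right _ _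
  obtain ⟨s, t, μ, hst, hst'⟩ : ∃ (s t : ℕ) (μ : ℝ), s + t = k - i ∧
      (t = s ∧ μ = 1 ∨ t = s + 1 ∧ μ = α) := by
    rcases Nat.even_or_odd' (k - i : ℕ) with ⟨s, h | h⟩
    · exact ⟨s, s, 1, by omega, Or.inl ⟨rfl, rfl⟩⟩
    · exact ⟨s, s + 1, α, by omega, Or.inr ⟨rfl, rfl⟩⟩
  have hs : 30000 ≤ s := by omega
  refine (hB n i j k _ _ s t (mainTerm α s) (mainTerm α t) μ hij hjk rfl rfl (by omega) hqp hst
    (signedBound_powSum_mainTerm' hα hs) (signedBound_powSum_mainTerm' hα (by omega))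
    (by rcases hst' with ⟨-, h⟩ | ⟨-, h⟩ <;> linarith)).mono ?_
  have := torus_bound_le hα hB1 (le_max_left B (Real.sqrt α)) hDα hs hst'
  rw [hst] at this
  have := mainTerm_pos hα (n := k - i) (by omega)
  linarith

lemma exists_coeffBound_gCoeff_distinct {α : ℝ} (hα : α ^ 3 - α ^ 2 - α - 1 = 0) :
    ∃ P : ℕ, ∀ (n : ℕ) (i j k : Fin (n + 1)), i < j → j < k → P ≤ (k - i : ℕ) →
      CoeffBound (gCoeff n (Finsupp.single i 1 + Finsupp.single j 1 + Finsupp.single k 1))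
        (0.99 * mainTerm α (k - i)) := by
  obtain ⟨P, hP⟩ := exists_coeffBound_gCoeff_half hα
  refine ⟨P, fun n i j k hij hjk hp => ?_⟩
  by_cases hqp : 2 * (j - i : ℕ) ≤ k - i
  · exact hP n i j k hij hjk hqp hp
  have hij' := Fin.lt_def.1 hij
  have hjk' := Fin.lt_def.1 hjk
  have hk := k.2
  have := hP n k.rev j.rev i.rev (Fin.rev_lt_rev.2 hjk) (Fin.rev_lt_rev.2 hij)
    (by simp only [Fin.val_rev]; omega) (by simp only [Fin.val_rev]; omega)
  have := coeffBound_gCoeff_rev this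
  simp only [Fin.rev_rev, Fin.val_rev] at this
  rw [show n + 1 - ((i : ℕ) + 1) - (n + 1 - (k + 1)) = k - i by omega] at this
  rwa [add_assoc, add_comm, add_comm (Finsupp.single j 1)] at this

lemma exists_const_le_mainTerm {α : ℝ} (hα : α ^ 3 - α ^ 2 - α - 1 = 0) (K : ℝ) :
    ∃ P : ℕ, ∀ p, P ≤ p → K ≤ 0.01 * mainTerm α p := by
  have := lt_root hα
  simpa using exists_pow_le_mainTerm hα zero_le_one (by linarith) K

/-- All the coefficients of `Res(f,g)` with a given monomial in `g` are bounded by the main term,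
up to a relative gain of order `1 / n`. -/
lemma exists_coeffBound_gCoeff_le {α : ℝ} (hα : α ^ 3 - α ^ 2 - α - 1 = 0) :
    ∃ N : ℕ, ∀ n : ℕ, N ≤ n → ∀ i j k : Fin (n + 1), i ≤ j → j ≤ k →
      CoeffBound (gCoeff n (Finsupp.single i 1 + Finsupp.single j 1 + Finsupp.single k 1))
        (mainTerm α n * (1 - 1 / 10 / n)) := by
  have hl := lt_root hα
  obtain ⟨P, hP⟩ := exists_coeffBound_gCoeff_distinct hα
  set Q := max P 30000 with hQ
  obtain ⟨R, hR⟩ := exists_const_le_mainTerm hα (6 * α ^ Q + 3)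
  refine ⟨max R 30001, fun n hn => ?_⟩
  have hn2 : 30001 ≤ n := (le_max_right _ _).trans hn
  have hRn := hR n ((le_max_left _ _).trans hn)
  have hm := mainTerm_pos hα (n := n) (by omega)
  have hnR : (30001 : ℝ) ≤ n := by exact_mod_cast hn2
  have hgain : 0.99 * mainTerm α n ≤ mainTerm α n * (1 - 1 / 10 / n) := by
    have : 1 / 10 / (n : ℝ) ≤ 0.01 := by
      rw [div_le_iff₀ (by linarith)]; linarith
    nlinarith
  have hQpos : 1 ≤ α ^ Q := one_le_pow₀ (by linarith)
  have hpow : ∀ p, p < Q → α ^ p ≤ α ^ Q := fun p hp => pow_le_pow_right₀ (by linarith) hp.le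
  have two : ∀ i k : Fin (n + 1), i < k →
      CoeffBound (gCoeff n (Finsupp.single i 1 + Finsupp.single i 1 + Finsupp.single k 1))
        (mainTerm α n * (1 - 1 / 10 / n)) := by
    intro i k hik
    have hik' := Fin.lt_def.1 hik
    by_cases hs : (k - i : ℕ) < Q
    · refine (coeffBound_gCoeff_two hik (signedBound_powSum_pow hα _)).mono ?_
      have := hpow _ hs
      linarith
    · have h3 : 30000 ≤ (k - i : ℕ) := (le_max_right P 30000).trans (by omega)
      by_cases he : (k - i : ℕ) = n
      · have h4 := coeffBound_gCoeff_two hik (signedBound_powSum_mainTerm hα h3)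
        rwa [he] at h4
      · refine (coeffBound_gCoeff_two hik (signedBound_powSum_mainTerm' hα h3)).mono ?_
        have hk := k.2
        have h4 := mainTerm_le_succ hα (n := n - 1) (by omega)
        have h5 := mainTerm_mono hα (n := k - i) (m := n - 1) (by omega) (by omega)
        rw [show n - 1 + 1 = n by omega] at h4
        linarith
  intro i j k hij hjk
  rcases hij.eq_or_lt with rfl | hij
  · rcases hjk.eq_or_lt with rfl | hjk
    · refine (coeffBound_gCoeff_one i).mono ?_
      linarith
    · exact two _ _ hjk
  · rcases hjk.eq_or_lt with rfl | hjk
    · have := coeffBound_gCoeff_rev (two j.rev i.rev (Fin.rev_lt_rev.2 hij))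
      simp only [Fin.rev_rev] at this
      rwa [add_assoc, add_comm]
    · have hij' := Fin.lt_def.1 hij
      have hjk' := Fin.lt_def.1 hjk
      have hk := k.2
      by_cases hs : (k - i : ℕ) < Q
      · refine (coeffBound_gCoeff_pow hα hij hjk).mono ?_
        have := hpow _ hs
        linarith
      · have h3 : P ≤ (k - i : ℕ) := (le_max_left P 30000).trans (by omega)
        have h4 : 30000 ≤ (k - i : ℕ) := (le_max_right P 30000).trans (by omega)
        refine (hP n i j k hij hjk h3).mono ?_
        have := mainTerm_mono hα (n := k - i) (m := n) (by omega) (by omega)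
        linarith

lemma gCoeff_eq_zero {n : ℕ} {d : Fin (n + 1) →₀ ℕ}
    (h : ∀ i j k : Fin (n + 1), Finsupp.single i 1 + Finsupp.single j 1 + Finsupp.single k 1 ≠ d) :
    gCoeff n d = 0 := by
  refine ext_of_aeval fun f _ hf => ?_
  obtain ⟨ρ, hρ⟩ := exists_hasRoots f hf
  rw [eval_gCoeff n d f ρ hρ, map_zero, symSum]
  simp [h]

lemma exists_coeffBound_gCoeff {α : ℝ} (hα : α ^ 3 - α ^ 2 - α - 1 = 0) :
    ∃ N : ℕ, ∀ n : ℕ, N ≤ n → ∀ d : Fin (n + 1) →₀ ℕ,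
      CoeffBound (gCoeff n d) (mainTerm α n * (1 - 1 / 10 / n)) := by
  obtain ⟨N, hN⟩ := exists_coeffBound_gCoeff_le hα
  refine ⟨N, fun n hn d => ?_⟩
  have H := hN n hn
  by_cases hd : ∃ i j k : Fin (n + 1),
      Finsupp.single i 1 + Finsupp.single j 1 + Finsupp.single k 1 = d
  · obtain ⟨i, j, k, rfl⟩ := hd
    rcases le_total i j with h1 | h1 <;> rcases le_total j k with h2 | h2 <;>
      rcases le_total i k with h3 | h3
    · exact H i j k h1 h2
    · exact H i j k h1 h2
    · rw [add_right_comm]; exact H i k j h3 h2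
    · rw [add_right_comm, add_comm (Finsupp.single i 1)]; exact H k i j h3 h1
    · rw [add_comm (Finsupp.single i 1)]; exact H j i k h1 h3
    · rw [add_assoc, add_comm]; exact H j k i h2 h3
    · rw [add_comm, ← add_assoc, add_right_comm]; exact H k j i h2 h1
    · rw [add_comm, add_comm (Finsupp.single i 1), ← add_assoc]; exact H k j i h2 h1
  · push Not at hd
    rw [gCoeff_eq_zero hd]
    intro u
    simpa [signedCoeff] using (H 0 0 0 le_rfl le_rfl).nonneg

lemma height_le {σ : Type*} {P : MvPolynomial σ ℤ} {B : ℝ} (hB : 0 ≤ B)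
    (h : ∀ s, |((coeff s P : ℤ) : ℝ)| ≤ B) : (height P : ℝ) ≤ B := by
  rw [← Nat.le_floor_iff hB]
  refine Finset.sup_le fun s _ => ?_
  rw [Nat.le_floor_iff hB, Nat.cast_natAbs, Int.cast_abs]
  exact h s

lemma le_height {σ : Type*} (P : MvPolynomial σ ℤ) (s : σ →₀ ℕ) :
    |((coeff s P : ℤ) : ℝ)| ≤ height P := by
  by_cases hs : s ∈ P.support
  · have := Finset.le_sup (f := fun s => (P.coeff s).natAbs) hs
    rw [← Int.cast_abs, ← Nat.cast_natAbs]
    exact_mod_cast this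
  · rw [notMem_support_iff.1 hs]
    simp

lemma exists_coeff_eq_signedCoeff (n : ℕ) (d : Fin (n + 1) →₀ ℕ) (u : Fin 4 →₀ ℕ) :
    ∃ s, |((coeff s (genRes 3 n) : ℤ) : ℝ)| = |signedCoeff (gCoeff n d) u| := by
  refine ⟨Finsupp.sumElim u d, ?_⟩
  rw [abs_signedCoeff, gCoeff, ← coeff_coeff_iterHom]
  congr 4
  all_goals ext x; simp [Finsupp.comapDomain]

lemma height_genRes_le {n : ℕ} {B : ℝ} (h : ∀ d, CoeffBound (gCoeff n d) B) :
    (height (genRes 3 n) : ℝ) ≤ B := by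
  refine height_le (h 0).nonneg fun s => ?_
  rw [← coeff_coeff_iterHom, ← abs_signedCoeff]
  exact h _ _

lemma wt_le_height {n : ℕ} (hn : 1 ≤ n) {a b c : ℕ} (h : a + 2 * b + 3 * c = n) :
    wt a b c ≤ height (genRes 3 n) := by
  let u : Fin 4 →₀ ℕ := Finsupp.equivFunOnFinite.symm ![c, b, a, b + 2 * c]
  have h0 : (0 : Fin (n + 1)) < Fin.last n := by
    rw [Fin.lt_def]; exact hn
  obtain ⟨s, hs⟩ := exists_coeff_eq_signedCoeff n
    (Finsupp.single 0 1 + Finsupp.single 0 1 + Finsupp.single (Fin.last n) 1) u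
  refine le_trans ?_ (le_height _ s)
  have h1 : signedCoeff (powSum n) u = wt a b c := by
    rw [signedCoeff_powSum]
    simp [u, h]
  rw [hs, gCoeff_two h0]
  have h2 : |signedCoeff (powSum n) u| = wt a b c := by rw [h1, abs_of_nonneg (wt_nonneg _ _ _)]
  rw [← h2, abs_signedCoeff, abs_signedCoeff]
  rcases neg_one_pow_eq_or (MvPolynomial (Fin 4) ℤ) (n * 3) with h3 | h3 <;> simp [sgn, h3]

lemma meanIdx_eq {α β : ℝ} (hα : α ^ 3 - α ^ 2 - α - 1 = 0)
    (hβ : β ^ 3 - 18 * β ^ 2 + 110 * β - 242 = 0) : α ^ 3 * meanIdx α ^ 2 / 2 = β := by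
  have hl := lt_root hα
  have hα0 : α ≠ 0 := by linarith
  set γ := α ^ 3 * meanIdx α ^ 2 / 2 with hγ
  have h1 : γ = -α ^ 2 + 3 * α + 6 := by
    rw [hγ, meanIdx]
    field_simp
    linear_combination (2 * α ^ 2 - 3 * α - 9) * hα
  have h2 : γ ^ 3 - 18 * γ ^ 2 + 110 * γ - 242 = 0 := by
    rw [h1]
    linear_combination (-α ^ 3 + 8 * α ^ 2 - 20 * α + 14) * hα
  have h3 : (γ - β) * ((γ + β / 2 - 9) ^ 2 + 3 / 4 * (β - 6) ^ 2 + 2) = 0 := by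
    linear_combination h2 - hβ
  rcases mul_eq_zero.1 h3 with h | h
  · linarith
  · nlinarith [sq_nonneg (γ + β / 2 - 9), sq_nonneg (β - 6)]

/-- Let `β ≈ 8.13488` be the real root of `x³-18x²+110x-242` and `α ≈ 1.83928` the real root
of `x³-x²-x-1`.  With `H(n)` the height of the resultant of a generic cubic with a generic
degree-`n` polynomial, there are constants `c₁, c₂ > 0` and `N` such that for all `n > N`:
`c₁ αⁿ/n² ≤ β αⁿ/(nπ) - H(n) ≤ c₂ αⁿ/n²`. -/
theorem height_cubic_asymptotics (α β : ℝ)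
    (hα : α ^ 3 - α ^ 2 - α - 1 = 0) (hβ : β ^ 3 - 18 * β ^ 2 + 110 * β - 242 = 0) :
    ∃ c₁ c₂ : ℝ, 0 < c₁ ∧ 0 < c₂ ∧ ∃ N : ℕ, ∀ n : ℕ, N < n →
      c₁ * α ^ n / (n : ℝ) ^ 2 ≤ β * α ^ n / (n * Real.pi) - (height (genRes 3 n) : ℝ) ∧
        β * α ^ n / (n * Real.pi) - (height (genRes 3 n) : ℝ) ≤ c₂ * α ^ n / (n : ℝ) ^ 2 := by
  have hl := lt_root hα
  have hm := (meanIdx_bounds hα).1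
  have hβ' := meanIdx_eq hα hβ
  have hπ := Real.pi_pos
  have hβ0 : 0 < β := by
    have : 0 < meanIdx α := by linarith
    have : 0 < α := by linarith
    rw [← hβ']; positivity
  obtain ⟨N, hN⟩ := exists_coeffBound_gCoeff hα
  refine ⟨β / Real.pi / 10, β / Real.pi * 15000, by positivity, by positivity, N + 3, fun n hn => ?_⟩
  have hn0 : (0 : ℝ) < n := by exact_mod_cast (show 0 < n by omega)
  have hmain : mainTerm α n = β * α ^ n / (n * Real.pi) := by
    rw [mainTerm, ← hβ']; field_simp; ring
  have hupper := height_genRes_le (hN n (by omega))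
  obtain ⟨a, b, c, habc, hw⟩ := exists_le_wt hα (n := n) (by omega)
  have hlower := hw.trans (wt_le_height (by omega) habc)
  rw [hmain] at hupper hlower
  constructor
  · have : β / Real.pi / 10 * α ^ n / (n : ℝ) ^ 2 =
        β * α ^ n / (n * Real.pi) - β * α ^ n / (n * Real.pi) * (1 - 1 / 10 / n) := by
      field_simp; ring
    linarith
  · have : β / Real.pi * 15000 * α ^ n / (n : ℝ) ^ 2 =
        β * α ^ n / (n * Real.pi) - β * α ^ n / (n * Real.pi) * (1 - 15000 / n) := by
      field_simp; ring
    linarith
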